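/- Let π be a dominant integral weight with Stab_W(π) = W_P, and let v ≤ w be π-minuscule elements in W^P. Fix a reduced expression w = s_{i_1}⋯s_{i_ℓ} with β_w(p_j) = s_{i_1}⋯s_{i_{j−1}}(α_{i_j}). Then #Red(w v^{−1}) = (ℓ(w) − ℓ(v))! · Σ_{D ∈ E_{H(w)}(H(v))} 1 / ∏_{p ∈ H(w) \ D} ht(β_w(p)). -/

import Mathlib

open scoped Classical BigOperators

/-- A bundled setting for a finite crystallographic root system together with its
Weyl group, its action on the rational span of the weight lattice, reflections,
and the data of coefficients of roots in the basis of simple roots. -/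
structure WeylSetting where
  /-- index set of the Dynkin diagram (simple roots) -/
  I : Type
  [fintypeI : Fintype I]
  [decEqI : DecidableEq I]
  /-- rational span of the weight lattice -/
  V : Type
  [acg : AddCommGroup V]
  [mod : Module ℚ V]
  /-- the Weyl group -/
  W : Type
  [grp : Group W]
  /-- the action of the Weyl group on weights -/
  act : W →* (V ≃ₗ[ℚ] V)
  /-- the simple roots -/
  simple : I → V
  /-- the (finite) set of roots -/
  roots : Finset V
  /-- `coroot β μ` is the pairing `⟨μ, β∨⟩` -/
  coroot : V → (V →ₗ[ℚ] ℚ)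
  /-- the reflection `s_β ∈ W` associated to a root `β` -/
  srefl : V → W
  /-- coefficients of a positive root in the basis of simple roots -/
  posCoeff : V → I → ℕ
  simple_mem : ∀ i, simple i ∈ roots
  simple_indep : LinearIndependent ℚ simple
  roots_neg : ∀ β ∈ roots, -β ∈ roots
  root_pos_or_neg : ∀ β ∈ roots,
    (∃ c : I → ℚ, (∀ i, 0 ≤ c i) ∧ β = ∑ i, c i • simple i) ∨
    (∃ c : I → ℚ, (∀ i, 0 ≤ c i) ∧ -β = ∑ i, c i • simple i)
  coroot_self : ∀ β ∈ roots, coroot β β = 2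
  crystallographic : ∀ β ∈ roots, ∀ γ ∈ roots, ∃ n : ℤ, coroot β γ = n
  posCoeff_spec : ∀ β ∈ roots,
    (∃ c : I → ℚ, (∀ i, 0 ≤ c i) ∧ β = ∑ i, c i • simple i) →
    β = ∑ i, (posCoeff β i : ℚ) • simple i
  srefl_apply : ∀ β ∈ roots, ∀ v : V, act (srefl β) v = v - coroot β v • β
  act_faithful : ∀ g : W, (∀ v : V, act g v = v) → g = 1
  roots_invariant : ∀ g : W, ∀ β ∈ roots, act g β ∈ roots
  coroot_equivariant : ∀ g : W, ∀ β ∈ roots, ∀ v : V,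
    coroot (act g β) (act g v) = coroot β v
  generated : ∀ g : W, ∃ l : List I, g = (l.map fun i => srefl (simple i)).prod

namespace WeylSetting

attribute [instance] fintypeI decEqI acg mod grp

variable (D : WeylSetting)

/-- the simple reflection attached to a node of the Dynkin diagram -/
def s (i : D.I) : D.W := D.srefl (D.simple i)

/-- the product `s_{i_1} ⋯ s_{i_r}` of the simple reflections listed in `l` -/
def wordProd (l : List D.I) : D.W := (l.map D.s).prod

/-- `β` is a positive root: a root which is a nonnegative combination of simple roots -/
def IsPosRoot (β : D.V) : Prop :=
  β ∈ D.roots ∧ ∃ c : D.I → ℚ, (∀ i, 0 ≤ c i) ∧ β = ∑ i, c i • D.simple i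

/-- the length of a Weyl group element -/
noncomputable def length (g : D.W) : ℕ :=
  sInf {n | ∃ l : List D.I, l.length = n ∧ D.wordProd l = g}

/-- `l` is a reduced word for `g` -/
def IsReduced (l : List D.I) (g : D.W) : Prop :=
  D.wordProd l = g ∧ l.length = D.length g

/-- the number of reduced words of `g` -/
noncomputable def RedCard (g : D.W) : ℕ := Nat.card {l : List D.I // D.IsReduced l g}

/-- the (strong) Bruhat order on the Weyl group -/
def bruhatLE : D.W → D.W → Prop :=
  Relation.ReflTransGen
    (fun a b => (∃ β, D.IsPosRoot β ∧ b = D.srefl β * a) ∧ D.length a < D.length b)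

/-- strict (strong) Bruhat order -/
def bruhatLT (a b : D.W) : Prop := D.bruhatLE a b ∧ a ≠ b

/-- the left weak Bruhat order: `a ≤_L b` iff `ℓ(b a⁻¹) + ℓ(a) = ℓ(b)` -/
def weakLE (a b : D.W) : Prop := D.length (b * a⁻¹) + D.length a = D.length b

/-- the height of a positive root: the sum of its coefficients in the simple roots -/
noncomputable def ht (β : D.V) : ℕ := ∑ i, D.posCoeff β i

/-- an integral weight: the pairings with all positive coroots are integers -/
def IsIntegral (lam : D.V) : Prop :=
  ∀ β, D.IsPosRoot β → ∃ n : ℤ, D.coroot β lam = n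

/-- a dominant integral weight -/
def IsDominant (lam : D.V) : Prop :=
  D.IsIntegral lam ∧ ∀ i, 0 ≤ D.coroot (D.simple i) lam

/-- a pre-dominant integral weight: `⟨λ, β∨⟩ ≥ -1` for all positive roots `β` -/
def IsPreDominant (lam : D.V) : Prop :=
  D.IsIntegral lam ∧ ∀ β, D.IsPosRoot β → -1 ≤ D.coroot β lam

/-- the diagram `D(λ) = {β ∈ R⁺ : ⟨λ, β∨⟩ = -1}` of a pre-dominant weight -/
noncomputable def diagram (lam : D.V) : Finset D.V :=
  D.roots.filter fun β => D.IsPosRoot β ∧ D.coroot β lam = -1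

/-- `IsWeightPath λ [β₁, …, β_r]` says that
`λ = λ₀ →β₁ λ₁ →β₂ ⋯ →β_r λ_r` is a `λ`-path, i.e. each `β_j` is a positive
root, `⟨λ_{j-1}, β_j∨⟩ = -1` and `λ_j = s_{β_j}(λ_{j-1})`. -/
def IsWeightPath : D.V → List D.V → Prop
  | _, [] => True
  | lam, β :: rest =>
      D.IsPosRoot β ∧ D.coroot β lam = -1 ∧
        IsWeightPath (D.act (D.srefl β) lam) rest

/-- the term `1/β₁ ⋅ 1/(β₁+β₂) ⋅ … ⋅ 1/(β₁+⋯+β_r)` attached to a path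
`(β₁, …, β_r)`, computed in a field `F` via a linear embedding `emb`. -/
noncomputable def pathTerm {F : Type} [Field F] [Algebra ℚ F]
    (emb : D.V →ₗ[ℚ] F) (l : List D.V) : F :=
  ∏ j ∈ Finset.range l.length, (emb ((l.take (j + 1)).sum))⁻¹

/-- `w` is a π-minuscule element (in the sense of Peterson). -/
def IsMinuscule (pi : D.V) (w : D.W) : Prop :=
  ∃ l : List D.I, D.IsReduced l w ∧
    ∀ k : Fin l.length,
      D.coroot (D.simple (l.get k)) (D.act (D.wordProd (l.drop (k.val + 1))) pi) = 1

/-- the stabilizer `W_π = Stab_W(π)` of a weight -/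
def stab (pi : D.V) : Subgroup D.W where
  carrier := {g | D.act g pi = pi}
  one_mem' := by simp
  mul_mem' := by
    intro a b ha hb
    simp only [Set.mem_setOf_eq] at *
    calc D.act (a * b) pi = D.act a (D.act b pi) := by rw [map_mul]; rfl
    _ = pi := by rw [hb, ha]
  inv_mem' := by
    intro a ha
    simp only [Set.mem_setOf_eq] at *
    calc D.act a⁻¹ pi = D.act a⁻¹ (D.act a pi) := by rw [ha]
    _ = D.act (a⁻¹ * a) pi := by rw [map_mul]; rfl
    _ = pi := by simp

/-- `u` is the minimal-length representative of its coset `uH` -/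
def IsMinRep (H : Subgroup D.W) (u : D.W) : Prop :=
  ∀ g : D.W, u⁻¹ * g ∈ H → D.length u ≤ D.length g

/-- `a` and `b` lie in the same coset of `H`, i.e. `aH = bH` -/
def SameCoset (H : Subgroup D.W) (a b : D.W) : Prop := a⁻¹ * b ∈ H

/-- `u →β w` in `W^P`: `β` is a positive root, `u, w` are minimal-length
representatives, `s_β w H = u H`, and `u < w` in Bruhat order -/
def Arrow (H : Subgroup D.W) (u w : D.W) (β : D.V) : Prop :=
  D.IsPosRoot β ∧ D.IsMinRep H u ∧ D.IsMinRep H w ∧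
    D.SameCoset H (D.srefl β * w) u ∧ D.bruhatLT u w

/-- `ArrowPath H w [β₁, …, β_r]` encodes a directed path
`x_r →β_r ⋯ → x_1 →β₁ x_0 = w` in the Bruhat graph on `W^P`. -/
def ArrowPath (H : Subgroup D.W) : D.W → List D.V → Prop
  | _, [] => True
  | w, β :: rest => ∃ u, D.Arrow H u w β ∧ ArrowPath H u rest

/-- directed paths as above whose vertices all lie above `v` in Bruhat order -/
def ArrowPathGE (H : Subgroup D.W) (v : D.W) : D.W → List D.V → Prop
  | _, [] => True
  | w, β :: rest => ∃ u, D.Arrow H u w β ∧ D.bruhatLE v u ∧ ArrowPathGE H v u rest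

/-- directed paths from `u` to `w`:
`u = x_r →β_r ⋯ → x_1 →β₁ x_0 = w` encoded by the list `[β₁, …, β_r]`. -/
def ArrowPathFromTo (H : Subgroup D.W) (u : D.W) : D.W → List D.V → Prop
  | w, [] => u = w
  | w, β :: rest => ∃ x, D.Arrow H x w β ∧ ArrowPathFromTo H u x rest

/-- `S(w) = {β ∈ R⁺ : s_β w < w}` -/
noncomputable def Sset (w : D.W) : Finset D.V :=
  D.roots.filter fun β => D.IsPosRoot β ∧ D.bruhatLT (D.srefl β * w) w

/-- `S(w/v) = {β ∈ R⁺ : v ≤ s_β w < w}` -/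
noncomputable def SsetSkew (v w : D.W) : Finset D.V :=
  D.roots.filter fun β =>
    D.IsPosRoot β ∧ D.bruhatLE v (D.srefl β * w) ∧ D.bruhatLT (D.srefl β * w) w

/-- an oriented edge `x → y` in the Bruhat graph of `G/P`: `x, y` are minimal
representatives, `xH < yH`, and `yH = x s_γ H` for some positive root `γ` -/
def GEdge (H : Subgroup D.W) (x y : D.W) : Prop :=
  D.IsMinRep H x ∧ D.IsMinRep H y ∧ D.bruhatLT x y ∧
    ∃ γ, D.IsPosRoot γ ∧ D.SameCoset H (x * D.srefl γ) y

/-- the (unique) positive root `γ` with `yH = x s_γ H` attached to an edge -/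
noncomputable def edgeRoot (H : Subgroup D.W) (x y : D.W) : D.V :=
  if h : ∃ γ, D.IsPosRoot γ ∧ D.SameCoset H (x * D.srefl γ) y then h.choose else 0

/-- `GChainTo H v t [x₁, …, x_r]` encodes a directed path
`v ≤ x_r → ⋯ → x_1 → x_0 = t` in the Bruhat graph of `G/P` -/
def GChainTo (H : Subgroup D.W) (v : D.W) : D.W → List D.W → Prop
  | _, [] => True
  | t, x :: rest => D.GEdge H x t ∧ D.bruhatLE v x ∧ GChainTo H v x rest

/-- the weighted term
`(m_Λ(x_r,x_{r-1})/W_Λ(x_r)) ⋯ (m_Λ(x_1,x_0)/W_Λ(x_1))` of a path in the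
`Λ`-Bruhat graph, computed in a field `F` via a linear embedding `emb`. -/
noncomputable def chainTerm {F : Type} [Field F] [Algebra ℚ F]
    (emb : D.V →ₗ[ℚ] F) (H : Subgroup D.W) (Lam : D.W → D.V) (w : D.W) :
    D.W → List D.W → F
  | _, [] => 1
  | t, x :: rest =>
      algebraMap ℚ F (D.coroot (D.edgeRoot H x t) (Lam x)) *
        (emb (D.act x (Lam x) - D.act w (Lam x)))⁻¹ *
        chainTerm emb H Lam w x rest

/-- the Bruhat order on cosets: `aH ≤ bH` -/
def cosetLE (H : Subgroup D.W) (a b : D.W) : Prop :=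
  ∃ x y, D.SameCoset H a x ∧ D.SameCoset H b y ∧ D.bruhatLE x y

/-- the (standard) parabolic subgroup generated by simple reflections in `J` -/
def parab (J : Set D.I) : Subgroup D.W := Subgroup.closure (D.s '' J)

/-- `X*(T)_P`: integral weights orthogonal to all coroots of `W_P`,
i.e. to `γ∨` for all positive roots `γ` in the span of the simple roots of `P` -/
def OrthWeightP (J : Set D.I) (lam : D.V) : Prop :=
  D.IsIntegral lam ∧
    ∀ γ, D.IsPosRoot γ → γ ∈ Submodule.span ℚ (D.simple '' J) → D.coroot γ lam = 0

/-- an admissible function `Λ : [v,w]^P → X*(T)_P` -/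
def Admissible (J : Set D.I) (v w : D.W) (Lam : D.W → D.V) : Prop :=
  (∀ x, D.IsMinRep (D.parab J) x → D.bruhatLE v x → D.bruhatLE x w →
      D.OrthWeightP J (Lam x)) ∧
  (∀ x, D.IsMinRep (D.parab J) x → D.bruhatLE v x → D.bruhatLE x w → x ≠ w →
      D.act x (Lam x) ≠ D.act w (Lam x))

/-- the subword of `l` with letters at the positions in `S`, in increasing order -/
def subwordF (l : List D.I) (S : Finset (Fin l.length)) : List D.I :=
  ((List.finRange l.length).filter fun j => j ∈ S).map l.get

/-- `β_j = s_{i_1} ⋯ s_{i_{j-1}}(α_{i_j})` attached to a reduced word `l` -/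
noncomputable def refRoot (l : List D.I) (j : Fin l.length) : D.V :=
  D.act (D.wordProd (l.take j.val)) (D.simple (l.get j))

/-- the Weyl group is simply laced: the Cartan pairing is symmetric -/
def SimplyLaced : Prop :=
  ∀ i j, D.coroot (D.simple i) (D.simple j) = D.coroot (D.simple j) (D.simple i)

/-- generating relation of the heap order of the word `l`:
`p_j < p_k` whenever `j < k` and `s_{i_j}`, `s_{i_k}` do not commute -/
def heapCovers (l : List D.I) (j k : Fin l.length) : Prop :=
  (j : ℕ) < (k : ℕ) ∧ D.s (l.get j) * D.s (l.get k) ≠ D.s (l.get k) * D.s (l.get j)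

/-- the heap order of the word `l`: the minimal partial order generated by
`heapCovers` -/
def heapLE (l : List D.I) : Fin l.length → Fin l.length → Prop :=
  Relation.ReflTransGen (D.heapCovers l)

/-- strict heap order -/
def heapLT (l : List D.I) (j k : Fin l.length) : Prop := D.heapLE l j k ∧ j ≠ k

/-- `F` is an order filter of the heap `H(w)` of the word `l` -/
def IsHeapFilter (l : List D.I) (F : Finset (Fin l.length)) : Prop :=
  ∀ j k, j ∈ F → D.heapLE l j k → k ∈ F

/-- `i` and `j` are joined by an edge of the Dynkin diagram -/
def adjDynkin (i j : D.I) : Prop := i ≠ j ∧ D.s i * D.s j ≠ D.s j * D.s i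

/-- an elementary excitation `A ▷ B` of subsets of the heap of the word `l` -/
def Excite (l : List D.I) (A B : Finset (Fin l.length)) : Prop :=
  ∃ p q, D.heapLT l p q ∧ l.get p = l.get q ∧ q ∈ A ∧ p ∈ B ∧
    A.erase q = B.erase p ∧
    (∀ z, D.heapLT l p z → D.heapLT l z q → l.get z ≠ l.get p) ∧
    ∀ u ∈ A, D.heapLE l p u → D.heapLE l u q → ¬ D.adjDynkin (l.get p) (l.get u)

/-- `A` is an excited diagram of `F` in the heap of the word `l`,
i.e. `A ∈ E_{H(w)}(F)` -/
def InExcited (l : List D.I) (F A : Finset (Fin l.length)) : Prop :=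
  Relation.ReflTransGen (D.Excite l) F A

end WeylSetting
namespace WeylSetting
section Basics
variable (D : WeylSetting)

theorem act_mul' (g h : D.W) (x : D.V) : D.act (g * h) x = D.act g (D.act h x) := by
  rw [map_mul]; rfl

theorem act_one' (x : D.V) : D.act 1 x = x := by simp

theorem act_inv_act (g : D.W) (x : D.V) : D.act g⁻¹ (D.act g x) = x := by
  rw [← act_mul']; simp

theorem act_act_inv (g : D.W) (x : D.V) : D.act g (D.act g⁻¹ x) = x := by
  rw [← act_mul']; simp

theorem act_s (i : D.I) (x : D.V) :
    D.act (D.s i) x = x - D.coroot (D.simple i) x • D.simple i :=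
  D.srefl_apply _ (D.simple_mem i) x

theorem coroot_simple_self (i : D.I) : D.coroot (D.simple i) (D.simple i) = 2 :=
  D.coroot_self _ (D.simple_mem i)

theorem coroot_act (g : D.W) (β : D.V) (hβ : β ∈ D.roots) (x : D.V) :
    D.coroot β (D.act g x) = D.coroot (D.act g⁻¹ β) x := by
  have := D.coroot_equivariant g (D.act g⁻¹ β) (D.roots_invariant _ _ hβ) x
  rwa [act_act_inv] at this

theorem ext_act (g h : D.W) (H : ∀ x, D.act g x = D.act h x) : g = h := by
  have : h⁻¹ * g = 1 := by
    apply D.act_faithful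
    intro v
    rw [act_mul', H, act_inv_act]
  exact (inv_mul_eq_one.mp this).symm

theorem s_sq (i : D.I) : D.s i * D.s i = 1 := by
  apply ext_act
  intro x
  simp only [act_mul', act_s, map_sub, map_smul, coroot_simple_self, act_one']
  module

theorem s_inv (i : D.I) : (D.s i)⁻¹ = D.s i := by
  rw [inv_eq_iff_mul_eq_one]; exact D.s_sq i

theorem act_s_s (i : D.I) (x : D.V) : D.act (D.s i) (D.act (D.s i) x) = x := by
  rw [← act_mul', s_sq, act_one']

noncomputable def form (u v : D.V) : ℚ := ∑ γ ∈ D.roots, D.coroot γ u * D.coroot γ v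

theorem form_act (g : D.W) (u v : D.V) : D.form (D.act g u) (D.act g v) = D.form u v := by
  unfold form
  refine Finset.sum_nbij' (fun γ => D.act g⁻¹ γ) (fun γ => D.act g γ) ?_ ?_ ?_ ?_ ?_
  · intro γ h; exact D.roots_invariant _ _ h
  · intro γ h; exact D.roots_invariant _ _ h
  · intro γ h; simp only [act_act_inv]
  · intro γ h; simp only [act_inv_act]
  · intro γ h; rw [coroot_act _ _ _ h, coroot_act _ _ _ h]

theorem form_comm (u v : D.V) : D.form u v = D.form v u := by
  unfold form; exact Finset.sum_congr rfl fun _ _ => mul_comm _ _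

theorem form_sub (u v x : D.V) : D.form u (v - x) = D.form u v - D.form u x := by
  unfold form; simp [mul_sub]

theorem form_smul (u v : D.V) (c : ℚ) : D.form u (c • v) = c * D.form u v := by
  unfold form; rw [Finset.mul_sum]; refine Finset.sum_congr rfl fun _ _ => ?_
  simp; ring

theorem form_sum (u : D.V) (c : D.I → ℚ) (f : D.I → D.V) :
    D.form u (∑ i, c i • f i) = ∑ i, c i * D.form u (f i) := by
  unfold form
  simp only [map_sum, map_smul, smul_eq_mul, Finset.mul_sum]
  rw [Finset.sum_comm]
  refine Finset.sum_congr rfl fun _ _ => Finset.sum_congr rfl fun _ _ => by ring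

theorem form_self_pos (β : D.V) (hβ : β ∈ D.roots) : 0 < D.form β β := by
  unfold form
  have h2 := D.coroot_self β hβ
  refine lt_of_lt_of_le (b := D.coroot β β * D.coroot β β) (by rw [h2]; norm_num) ?_
  exact Finset.single_le_sum (f := fun γ => D.coroot γ β * D.coroot γ β)
    (fun γ _ => mul_self_nonneg _) hβ

theorem coroot_form (β : D.V) (hβ : β ∈ D.roots) (x : D.V) :
    D.coroot β x * D.form β β = 2 * D.form β x := by
  have h := D.form_act (D.srefl β) β x
  rw [D.srefl_apply β hβ, D.srefl_apply β hβ, D.coroot_self β hβ, form_sub, form_smul] at h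
  have e : β - (2:ℚ) • β = (-1 : ℚ) • β := by module
  rw [e, form_comm, form_smul, form_comm D ((-1 : ℚ) • β) β, form_smul, form_comm D x β] at h
  linarith

theorem root_ne_zero (β : D.V) (hβ : β ∈ D.roots) : β ≠ 0 := by
  intro h; have := D.coroot_self β hβ; rw [h] at this; simp at this

theorem coroot_smul (β γ : D.V) (hβ : β ∈ D.roots) (hγ : γ ∈ D.roots) (c : ℚ)
    (h : β = c • γ) (x : D.V) : c * D.coroot β x = D.coroot γ x := by
  have hc : c ≠ 0 := by
    rintro rfl; exact D.root_ne_zero β hβ (by simpa using h)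
  have h1 := D.coroot_form β hβ x
  have h2 := D.coroot_form γ hγ x
  have h3 := D.form_self_pos γ hγ
  rw [h] at h1
  rw [form_smul, form_comm D (c • γ) γ, form_smul, form_comm D (c • γ) x, form_smul,
    form_comm D x γ] at h1
  rw [← h] at h1
  have : (c * D.coroot β x) * D.form γ γ * c = D.coroot γ x * D.form γ γ * c := by
    rw [h2]; linarith
  have h4 := mul_right_cancel₀ hc this
  exact mul_right_cancel₀ h3.ne' h4

theorem coroot_neg (β : D.V) (hβ : β ∈ D.roots) (x : D.V) :
    D.coroot (-β) x = - D.coroot β x := by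
  have := D.coroot_smul (-β) β (D.roots_neg β hβ) hβ (-1) (by module) x
  linarith

theorem srefl_smul (β γ : D.V) (hβ : β ∈ D.roots) (hγ : γ ∈ D.roots) (c : ℚ)
    (h : β = c • γ) : D.srefl β = D.srefl γ := by
  apply ext_act
  intro x
  rw [D.srefl_apply _ hβ, D.srefl_apply _ hγ, ← D.coroot_smul β γ hβ hγ c h x]
  rw [mul_comm, mul_smul, ← h]

theorem srefl_conj (β : D.V) (hβ : β ∈ D.roots) (g : D.W) :
    D.srefl (D.act g β) = g * D.srefl β * g⁻¹ := by
  apply ext_act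
  intro x
  rw [D.srefl_apply _ (D.roots_invariant _ _ hβ), act_mul', act_mul', D.srefl_apply _ hβ,
    map_sub, map_smul, act_act_inv, coroot_act _ g⁻¹ _ hβ, inv_inv]

theorem simple_coeff (a b : D.I → ℚ) (h : ∑ i, a i • D.simple i = ∑ i, b i • D.simple i) :
    a = b := by
  funext i
  have h0 : ∑ i, (a i - b i) • D.simple i = 0 := by
    simp only [sub_smul, Finset.sum_sub_distrib, h, sub_self]
  have := Fintype.linearIndependent_iff.mp D.simple_indep _ h0 i
  linarith

theorem isPosRoot_simple (i : D.I) : D.IsPosRoot (D.simple i) := by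
  refine ⟨D.simple_mem i, fun j => if j = i then 1 else 0, fun j => by dsimp only; split_ifs <;> norm_num, ?_⟩
  simp

theorem pos_or_neg (β : D.V) (hβ : β ∈ D.roots) : D.IsPosRoot β ∨ D.IsPosRoot (-β) := by
  rcases D.root_pos_or_neg β hβ with h | h
  · exact Or.inl ⟨hβ, h⟩
  · exact Or.inr ⟨D.roots_neg β hβ, h⟩

theorem not_pos_neg (β : D.V) (h1 : D.IsPosRoot β) (h2 : D.IsPosRoot (-β)) : False := by
  obtain ⟨hβ, c, hc, e⟩ := h1
  obtain ⟨_, d, hd, e'⟩ := h2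
  have h0 : ∑ i, (c i + d i) • D.simple i = ∑ i, (0 : ℚ) • D.simple i := by
    simp only [add_smul, Finset.sum_add_distrib, ← e, ← e']; simp
  have := D.simple_coeff _ _ h0
  have hc0 : ∀ i, c i = 0 := fun i => by
    have := congrFun this i
    linarith [hc i, hd i]
  apply D.root_ne_zero β hβ
  rw [e]; simp [hc0]

theorem coroot_dom_nonneg (x : D.V) (hx : ∀ i, 0 ≤ D.coroot (D.simple i) x)
    (β : D.V) (hβ : D.IsPosRoot β) : 0 ≤ D.coroot β x := by
  obtain ⟨hr, c, hc, e⟩ := hβ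
  have h1 := D.coroot_form β hr x
  have h2 := D.form_self_pos β hr
  have h3 : 0 ≤ D.form β x := by
    rw [form_comm]
    conv_rhs => rw [e]
    rw [form_sum]
    refine Finset.sum_nonneg fun i _ => mul_nonneg (hc i) ?_
    have h4 := D.coroot_form (D.simple i) (D.simple_mem i) x
    have h5 := D.form_self_pos _ (D.simple_mem i)
    have := mul_nonneg (hx i) h5.le
    rw [form_comm]; linarith
  by_contra hneg
  push Not at hneg
  have := mul_neg_of_neg_of_pos hneg h2
  linarith

/-- a positive root stays positive under a simple reflection unless proportional -/
theorem s_pos (i : D.I) (β : D.V) (hβ : D.IsPosRoot β) :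
    D.IsPosRoot (D.act (D.s i) β) ∨ ∃ n : ℕ, 1 ≤ n ∧ β = (n : ℚ) • D.simple i := by
  rcases D.pos_or_neg _ (D.roots_invariant (D.s i) β hβ.1) with h | h
  · exact Or.inl h
  right
  have e := D.posCoeff_spec β hβ.1 hβ.2
  obtain ⟨_, d, hd, e'⟩ := h
  rw [act_s] at e'
  have h0 : ∑ j, ((D.posCoeff β j : ℚ) + d j) • D.simple j
      = ∑ j, (if j = i then D.coroot (D.simple i) β else 0) • D.simple j := by
    simp only [add_smul, Finset.sum_add_distrib, ← e, ← e']; simp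
  have h1 := D.simple_coeff _ _ h0
  have h2 : ∀ j, j ≠ i → (D.posCoeff β j : ℚ) = 0 := fun j hj => by
    have := congrFun h1 j
    simp only [hj, if_false] at this
    have h3 : (0 : ℚ) ≤ D.posCoeff β j := by positivity
    linarith [hd j]
  have h3 : β = (D.posCoeff β i : ℚ) • D.simple i := by
    conv_lhs => rw [e]
    rw [Finset.sum_eq_single i]
    · intro j _ hj; rw [h2 j hj, zero_smul]
    · simp
  refine ⟨D.posCoeff β i, ?_, h3⟩
  rw [Nat.one_le_iff_ne_zero]
  intro h4
  rw [h4] at h3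
  exact D.root_ne_zero β hβ.1 (by simpa using h3)

theorem cartan_nonpos (i j : D.I) (hij : j ≠ i) : D.coroot (D.simple i) (D.simple j) ≤ 0 := by
  rcases D.s_pos i (D.simple j) (D.isPosRoot_simple j) with h | ⟨n, hn, h⟩
  · obtain ⟨_, c, hc, e⟩ := h
    rw [act_s] at e
    have h0 : ∑ k, ((if k = j then (1:ℚ) else 0) - (if k = i then D.coroot (D.simple i) (D.simple j) else 0)) • D.simple k
      = ∑ k, c k • D.simple k := by
      rw [← e]; simp [sub_smul]
    have h1 := congrFun (D.simple_coeff _ _ h0) i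
    simp only [if_true, if_neg hij.symm] at h1
    linarith [hc i]
  · exfalso
    have h0 : ∑ k, (if k = j then (1:ℚ) else 0) • D.simple k
      = ∑ k, (if k = i then (n : ℚ) else 0) • D.simple k := by
      simp only [ite_smul, one_smul, zero_smul, Finset.sum_ite_eq', Finset.mem_univ, if_true]
      exact h
    have h1 := congrFun (D.simple_coeff _ _ h0) j
    simp [hij] at h1

theorem cartan_int (i j : D.I) : ∃ n : ℤ, D.coroot (D.simple i) (D.simple j) = n :=
  D.crystallographic _ (D.simple_mem i) _ (D.simple_mem j)

theorem cartan_zero_symm (i j : D.I) (h : D.coroot (D.simple i) (D.simple j) = 0) :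
    D.coroot (D.simple j) (D.simple i) = 0 := by
  have h1 := D.coroot_form _ (D.simple_mem i) (D.simple j)
  have h2 := D.coroot_form _ (D.simple_mem j) (D.simple i)
  rw [h, zero_mul] at h1
  rw [form_comm D (D.simple j) (D.simple i)] at h2
  have h3 := D.form_self_pos _ (D.simple_mem j)
  have : D.coroot (D.simple j) (D.simple i) * D.form (D.simple j) (D.simple j) = 0 := by
    linarith
  exact (mul_eq_zero.mp this).resolve_right h3.ne'

theorem commute_of_zero (i j : D.I) (h : D.coroot (D.simple i) (D.simple j) = 0) :
    D.s i * D.s j = D.s j * D.s i := by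
  have h' := D.cartan_zero_symm i j h
  apply ext_act
  intro x
  simp only [act_mul', act_s, map_sub, map_smul, h, h']
  module

theorem zero_of_commute (i j : D.I) (hij : i ≠ j) (h : D.s i * D.s j = D.s j * D.s i) :
    D.coroot (D.simple i) (D.simple j) = 0 := by
  have h1 : D.act (D.s i * D.s j) (D.simple j) = D.act (D.s j * D.s i) (D.simple j) := by rw [h]
  simp only [act_mul', act_s, map_sub, map_smul, coroot_simple_self] at h1
  set c := D.coroot (D.simple i) (D.simple j)
  set c' := D.coroot (D.simple j) (D.simple i)
  have h0 : ∑ k, ((if k = i then (2 * c:ℚ) else 0)) • D.simple k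
      = ∑ k, ((if k = j then (c * c') else 0)) • D.simple k := by
    simp only [ite_smul, zero_smul, Finset.sum_ite_eq', Finset.mem_univ, if_true]
    have : (2 * c) • D.simple i - (c * c') • D.simple j = 0 := by
      rw [← sub_eq_zero] at h1
      rw [← h1]; module
    exact sub_eq_zero.mp this
  have h1 := congrFun (D.simple_coeff _ _ h0) i
  simp only [if_true, if_neg hij] at h1
  linarith

theorem adj_iff (i j : D.I) : D.adjDynkin i j ↔ i ≠ j ∧ D.coroot (D.simple i) (D.simple j) ≠ 0 := by
  unfold adjDynkin
  constructor
  · rintro ⟨h, h'⟩; exact ⟨h, fun h0 => h' (D.commute_of_zero i j h0)⟩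
  · rintro ⟨h, h'⟩; exact ⟨h, fun h0 => h' (D.zero_of_commute i j h h0)⟩

theorem ncomm_iff (i j : D.I) : D.s i * D.s j ≠ D.s j * D.s i ↔
    i ≠ j ∧ D.coroot (D.simple i) (D.simple j) ≠ 0 := by
  rw [← adj_iff]; unfold adjDynkin
  constructor
  · intro h; exact ⟨fun e => h (by rw [e]), h⟩
  · exact fun h => h.2

theorem coroot_act_s (i j : D.I) (x : D.V) : D.coroot (D.simple i) (D.act (D.s j) x) =
    D.coroot (D.simple i) x - D.coroot (D.simple j) x * D.coroot (D.simple i) (D.simple j) := by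
  rw [act_s]; simp

end Basics
end WeylSetting
namespace WeylSetting
section Words
variable (D : WeylSetting)

theorem wordProd_nil : D.wordProd [] = 1 := rfl
theorem wordProd_cons (i : D.I) (l : List D.I) : D.wordProd (i :: l) = D.s i * D.wordProd l := by
  simp [wordProd]
theorem wordProd_append (l m : List D.I) : D.wordProd (l ++ m) = D.wordProd l * D.wordProd m := by
  simp [wordProd]
theorem wordProd_reverse (l : List D.I) : D.wordProd l.reverse = (D.wordProd l)⁻¹ := by
  induction l with
  | nil => simp [wordProd]
  | cons i l ih =>
    rw [List.reverse_cons, wordProd_append, ih, wordProd_cons D i l, mul_inv_rev, s_inv,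
      wordProd_cons, wordProd_nil, mul_one]

theorem length_le (l : List D.I) (g : D.W) (h : D.wordProd l = g) : D.length g ≤ l.length :=
  Nat.sInf_le ⟨l, rfl, h⟩

theorem exists_reduced (g : D.W) : ∃ l, D.IsReduced l g := by
  have hne : {n | ∃ l : List D.I, l.length = n ∧ D.wordProd l = g}.Nonempty := by
    obtain ⟨l, hl⟩ := D.generated g
    exact ⟨_, l, rfl, hl.symm⟩
  obtain ⟨l, h1, h2⟩ := Nat.sInf_mem hne
  exact ⟨l, h2, h1⟩

theorem length_mul_le (g h : D.W) : D.length (g * h) ≤ D.length g + D.length h := by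
  obtain ⟨l, hl, hl'⟩ := D.exists_reduced g
  obtain ⟨m, hm, hm'⟩ := D.exists_reduced h
  rw [← hl', ← hm', ← List.length_append]
  exact D.length_le _ _ (by rw [wordProd_append, hl, hm])

theorem exchange (l : List D.I) : ∀ (β : D.V), D.IsPosRoot β →
    ¬ D.IsPosRoot (D.act (D.wordProd l)⁻¹ β) →
    ∃ l', l'.length + 1 = l.length ∧ D.wordProd l' = D.srefl β * D.wordProd l := by
  induction l with
  | nil => intro β h1 h2; exfalso; apply h2; simpa [wordProd] using h1
  | cons j l ih =>
    intro β h1 h2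
    rw [wordProd_cons, mul_inv_rev, s_inv, act_mul'] at h2
    rcases D.s_pos j β h1 with h | ⟨n, hn, h⟩
    · obtain ⟨l', hl, hl'⟩ := ih _ h h2
      refine ⟨j :: l', by simp [hl], ?_⟩
      rw [wordProd_cons, hl', srefl_conj _ _ h1.1, wordProd_cons, s_inv]
      simp only [← mul_assoc, s_sq, one_mul]
    · refine ⟨l, by simp, ?_⟩
      rw [D.srefl_smul β _ h1.1 (D.simple_mem j) n h, wordProd_cons, ← mul_assoc]
      change _ = D.s j * D.s j * _
      rw [s_sq, one_mul]

theorem length_descent (i : D.I) (g : D.W) (h : ¬ D.IsPosRoot (D.act g⁻¹ (D.simple i))) :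
    D.length (D.s i * g) < D.length g := by
  obtain ⟨l, hl, hl'⟩ := D.exists_reduced g
  obtain ⟨l', h1, h2⟩ := D.exchange l _ (D.isPosRoot_simple i) (by rwa [hl])
  have := D.length_le l' (D.s i * g) (by rw [h2, hl]; rfl)
  omega

/-- the words along which all pairings are one -/
def MinW (pi : D.V) : List D.I → Prop
  | [] => True
  | i :: m => D.coroot (D.simple i) (D.act (D.wordProd m) pi) = 1 ∧ MinW pi m

theorem MinW_of_forall (pi : D.V) (l : List D.I)
    (h : ∀ k : Fin l.length,
      D.coroot (D.simple (l.get k)) (D.act (D.wordProd (l.drop (k.val + 1))) pi) = 1) :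
    D.MinW pi l := by
  induction l with
  | nil => trivial
  | cons i m ih =>
    refine ⟨by simpa using h ⟨0, by simp⟩, ih fun k => ?_⟩
    simpa using h k.succ

theorem MinW_suffix (pi : D.V) (l m : List D.I) (h : D.MinW pi l) (hs : m <:+ l) :
    D.MinW pi m := by
  induction l with
  | nil => rw [List.suffix_nil] at hs; rw [hs]; trivial
  | cons i l ih =>
    rcases List.suffix_cons_iff.mp hs with rfl | h'
    · exact h
    · exact ih h.2 h'

theorem MinW_weight (pi : D.V) (l : List D.I) (h : D.MinW pi l) :
    D.act (D.wordProd l) pi = pi - ∑ j, ((l.count j : ℕ) : ℚ) • D.simple j := by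
  induction l with
  | nil => simp [wordProd]
  | cons i m ih =>
    rw [wordProd_cons, act_mul', act_s, h.1, ih h.2]
    have : ∀ j, (((i :: m).count j : ℕ) : ℚ) • D.simple j
      = ((m.count j : ℕ) : ℚ) • D.simple j + (if j = i then (1:ℚ) else 0) • D.simple j := by
      intro j
      rw [List.count_cons]
      by_cases hj : j = i
      · subst hj; simp [add_smul]
      · simp [hj, Ne.symm hj]
    simp only [this, Finset.sum_add_distrib]
    simp
    abel

theorem MinW_ht (φ : D.V →ₗ[ℚ] ℚ) (hφ : ∀ i, φ (D.simple i) = 1) (pi : D.V) (l : List D.I)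
    (h : D.MinW pi l) : φ (pi - D.act (D.wordProd l) pi) = l.length := by
  induction l with
  | nil => simp [wordProd]
  | cons i m ih =>
    have := ih h.2
    rw [wordProd_cons, act_mul', act_s, h.1]
    simp only [map_sub, map_smul, hφ, List.length_cons] at this ⊢
    push_cast
    simp only [smul_eq_mul]
    linarith

theorem exists_ht : ∃ φ : D.V →ₗ[ℚ] ℚ, ∀ i, φ (D.simple i) = 1 := by
  let b := Module.Basis.extend D.simple_indep.linearIndepOn_id
  refine ⟨b.constr ℚ fun _ => (1 : ℚ), fun i => ?_⟩
  have hm : D.simple i ∈ D.simple_indep.linearIndepOn_id.extend (Set.subset_univ _) :=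
    LinearIndepOn.subset_extend _ _ ⟨i, rfl⟩
  have e : D.simple i = b ⟨D.simple i, hm⟩ := by simp [b]
  rw [e, Module.Basis.constr_basis]

theorem allPos_ht (φ : D.V →ₗ[ℚ] ℚ) (hφ : ∀ i, φ (D.simple i) = 1) (pi : D.V) (l : List D.I)
    (h : ∀ i m, (i :: m) <:+ l → 1 ≤ D.coroot (D.simple i) (D.act (D.wordProd m) pi)) :
    (l.length : ℚ) ≤ φ (pi - D.act (D.wordProd l) pi) ∧
    (φ (pi - D.act (D.wordProd l) pi) = l.length → D.MinW pi l) := by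
  induction l with
  | nil => simp [wordProd, MinW]
  | cons i m ih =>
    obtain ⟨h1, h2⟩ := ih fun j n hn => h j n (hn.trans (List.suffix_cons i m))
    have h3 := h i m List.suffix_rfl
    have e : φ (pi - D.act (D.wordProd (i :: m)) pi) = φ (pi - D.act (D.wordProd m) pi) +
        D.coroot (D.simple i) (D.act (D.wordProd m) pi) := by
      rw [wordProd_cons, act_mul', act_s]
      simp only [map_sub, map_smul, hφ, smul_eq_mul]; ring
    rw [e]
    simp only [List.length_cons]
    push_cast
    refine ⟨by linarith, fun h4 => ⟨by linarith, h2 (by linarith)⟩⟩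

theorem red_suffix_pos (l : List D.I) (w : D.W) (hl : D.IsReduced l w) (a : List D.I) (i : D.I)
    (m : List D.I) (e : l = a ++ i :: m) :
    D.IsPosRoot (D.act (D.wordProd m)⁻¹ (D.simple i)) := by
  by_contra hn
  obtain ⟨l', h1, h2⟩ := D.exchange m _ (D.isPosRoot_simple i) hn
  have := D.length_le (a ++ l') w (by
    rw [wordProd_append, h2, ← hl.1, e, wordProd_append, wordProd_cons]; rfl)
  rw [← hl.2, e] at this
  simp at this
  omega

theorem red_prefix_pos (l : List D.I) (w : D.W) (hl : D.IsReduced l w) (a : List D.I) (i : D.I)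
    (m : List D.I) (e : l = a ++ i :: m) :
    D.IsPosRoot (D.act (D.wordProd a) (D.simple i)) := by
  by_contra hn
  obtain ⟨l', h1, h2⟩ := D.exchange a.reverse _ (D.isPosRoot_simple i) (by
    rwa [wordProd_reverse, inv_inv])
  have := D.length_le (l'.reverse ++ m) w (by
    rw [wordProd_append, wordProd_reverse, h2, ← hl.1, e, wordProd_append, wordProd_cons,
      wordProd_reverse]
    change (D.s i * _)⁻¹ * _ = _
    rw [mul_inv_rev, s_inv, inv_inv, mul_assoc])
  rw [← hl.2, e] at this
  simp at this h1
  omega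

theorem red_MinW (pi : D.V) (hpi : D.IsDominant pi) (w : D.W) (hw : D.IsMinuscule pi w)
    (hwr : D.IsMinRep (D.stab pi) w) (l : List D.I) (hl : D.IsReduced l w) : D.MinW pi l := by
  obtain ⟨φ, hφ⟩ := D.exists_ht
  obtain ⟨l0, hl0, hl1⟩ := hw
  have h0 := D.MinW_ht φ hφ pi l0 (D.MinW_of_forall pi l0 hl1)
  refine (D.allPos_ht φ hφ pi l ?_).2 ?_
  · rintro i m ⟨a, e⟩
    have hp := D.red_suffix_pos l w hl a i m e.symm
    have h1 := D.coroot_dom_nonneg pi hpi.2 _ hp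
    obtain ⟨n, hn⟩ := hpi.1 _ hp
    rw [← coroot_act _ _ _ (D.simple_mem i)] at h1 hn
    have h2 : D.coroot (D.simple i) (D.act (D.wordProd m) pi) ≠ 0 := by
      intro h3
      have h4 := hwr (D.wordProd (a ++ m)) (by
        change D.act _ pi = pi
        rw [act_mul', wordProd_append, act_mul', ← hl.1, ← e, wordProd_append]
        have : D.act (D.wordProd m) pi = D.act (D.wordProd (i :: m)) pi := by
          rw [wordProd_cons, act_mul', act_s, h3]; simp
        rw [this, ← act_mul' D (D.wordProd a), act_inv_act])
      have h5 := D.length_le (a ++ m) _ rfl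
      rw [← hl.2, ← e] at h4
      simp at h4 h5
      omega
    rw [hn] at h1 h2 ⊢
    have : (0:ℤ) ≤ n := by exact_mod_cast h1
    have : n ≠ 0 := by exact_mod_cast h2
    have : (1:ℤ) ≤ n := by omega
    exact_mod_cast this
  · rw [hl.1, hl.2, ← hl0.2, ← h0, hl0.1]

theorem MinW_uniq (pi : D.V) (hpi : D.IsDominant pi) (l : List D.I) (hl : D.MinW pi l) :
    ∀ x : D.W, D.act x pi = D.act (D.wordProd l) pi → D.length x ≤ l.length →
      x = D.wordProd l := by
  induction l with
  | nil =>
    intro x _ h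
    obtain ⟨m, hm, hm'⟩ := D.exists_reduced x
    have : m = [] := by
      apply List.eq_nil_of_length_eq_zero
      simp at h; omega
    rw [← hm, this]
  | cons i m ih =>
    intro x hx hlen
    have h1 : D.coroot (D.simple i) (D.act x pi) = -1 := by
      rw [hx, wordProd_cons, act_mul', coroot_act_s, hl.1, coroot_simple_self]; norm_num
    have h2 : ¬ D.IsPosRoot (D.act x⁻¹ (D.simple i)) := by
      intro hp
      have := D.coroot_dom_nonneg pi hpi.2 _ hp
      rw [← coroot_act _ _ _ (D.simple_mem i), h1] at this
      norm_num at this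
    have h3 := D.length_descent i x h2
    have h4 := ih hl.2 (D.s i * x) (by
      rw [act_mul', hx, wordProd_cons, act_mul', act_s_s]) (by simp at hlen; omega)
    rw [wordProd_cons, ← h4, ← mul_assoc, s_sq, one_mul]

/-- predominance and simple steps -/
theorem pre_step (x : D.V) (hx : D.IsPreDominant x) (i : D.I)
    (hi : D.coroot (D.simple i) x ≤ 1) : D.IsPreDominant (D.act (D.s i) x) := by
  have key : ∀ β, D.IsPosRoot β → D.IsPosRoot (D.act (D.s i) β) ∨
      (D.coroot β (D.act (D.s i) x) = - D.coroot β x ∧ -1 ≤ D.coroot β (D.act (D.s i) x)) := by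
    intro β hβ
    rcases D.s_pos i β hβ with h | ⟨n, hn, h⟩
    · exact Or.inl h
    · right
      have e : D.coroot β (D.act (D.s i) x) = - D.coroot β x := by
        rw [coroot_act _ _ _ hβ.1, s_inv]
        have : D.act (D.s i) β = -β := by
          rw [h, map_smul, act_s, coroot_simple_self]; module
        rw [this, coroot_neg _ _ hβ.1]
      refine ⟨e, ?_⟩
      rw [e]
      have h1 := D.coroot_smul β _ hβ.1 (D.simple_mem i) n h x
      have hn' : (1:ℚ) ≤ n := by exact_mod_cast hn
      nlinarith
  constructor
  · intro β hβ
    rcases key β hβ with h | h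
    · rw [coroot_act _ _ _ hβ.1, s_inv]; exact hx.1 _ h
    · obtain ⟨n, hn⟩ := hx.1 β hβ
      exact ⟨-n, by rw [h.1, hn]; simp⟩
  · intro β hβ
    rcases key β hβ with h | h
    · rw [coroot_act _ _ _ hβ.1, s_inv]; exact hx.2 _ h
    · exact h.2

theorem dom_pre (pi : D.V) (hpi : D.IsDominant pi) : D.IsPreDominant pi :=
  ⟨hpi.1, fun β hβ => by linarith [D.coroot_dom_nonneg pi hpi.2 β hβ]⟩

end Words
end WeylSetting
namespace WeylSetting

/-- remove the position `0` and shift -/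
def tl {n : ℕ} (A : Finset (Fin (n + 1))) : Finset (Fin n) :=
  Finset.univ.filter fun j => j.succ ∈ A

/-- shift up by one -/
def up {n : ℕ} (A : Finset (Fin n)) : Finset (Fin (n + 1)) := A.map (Fin.succEmb n)

/-- the position `0` belongs to the set -/
def hd {n : ℕ} (A : Finset (Fin (n + 1))) : Prop := (0 : Fin (n + 1)) ∈ A

theorem mem_tl {n : ℕ} (A : Finset (Fin (n + 1))) (j : Fin n) : j ∈ tl A ↔ j.succ ∈ A := by
  simp [tl]

theorem succ_mem_up {n : ℕ} (A : Finset (Fin n)) (j : Fin n) : j.succ ∈ up A ↔ j ∈ A := by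
  simp [up]

theorem zero_mem_up {n : ℕ} (A : Finset (Fin n)) : (0 : Fin (n + 1)) ∉ up A := by
  simp [up, Fin.succ_ne_zero]

theorem tl_up {n : ℕ} (A : Finset (Fin n)) : tl (up A) = A := by
  ext j; rw [mem_tl, succ_mem_up]

theorem tl_insert_up {n : ℕ} (A : Finset (Fin n)) : tl (insert 0 (up A)) = A := by
  ext j; rw [mem_tl, Finset.mem_insert, succ_mem_up]; simp [Fin.succ_ne_zero]

theorem eq_up {n : ℕ} (A : Finset (Fin (n + 1))) (h : ¬ hd A) : A = up (tl A) := by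
  ext j
  refine Fin.cases ?_ (fun j => ?_) j
  · exact iff_of_false h (zero_mem_up _)
  · rw [succ_mem_up, mem_tl]

theorem eq_insert_up {n : ℕ} (A : Finset (Fin (n + 1))) (h : hd A) : A = insert 0 (up (tl A)) := by
  ext j
  refine Fin.cases ?_ (fun j => ?_) j
  · exact iff_of_true h (Finset.mem_insert_self _ _)
  · rw [Finset.mem_insert, succ_mem_up, mem_tl]; simp [Fin.succ_ne_zero]

theorem sum_finset_succ {n : ℕ} (f : Finset (Fin (n + 1)) → ℚ) :
    ∑ A, f A = ∑ A : Finset (Fin n), f (up A) + ∑ A : Finset (Fin n), f (insert 0 (up A)) := by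
  rw [← Finset.sum_filter_add_sum_filter_not Finset.univ (fun A => ¬ hd A)]
  congr 1
  · refine Finset.sum_nbij' tl up ?_ ?_ ?_ ?_ ?_
    · simp
    · intro A _; exact Finset.mem_filter.mpr ⟨Finset.mem_univ _, zero_mem_up A⟩
    · intro A hA; exact (eq_up A (by simpa using hA)).symm
    · intro A _; exact tl_up A
    · intro A hA; rw [← eq_up A (by simpa using hA)]
  · refine Finset.sum_nbij' tl (fun A => insert 0 (up A)) ?_ ?_ ?_ ?_ ?_
    · simp
    · intro A _; simp [hd]
    · intro A hA; exact (eq_insert_up A (by simpa using hA)).symm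
    · intro A _; exact tl_insert_up A
    · intro A hA; rw [← eq_insert_up A (by simpa using hA)]

section Good
variable (D : WeylSetting) (pi : D.V)

/-- the subset `A` of positions of the word `l` is a minuscule path from `pi` to `x` -/
def Good : (l : List D.I) → D.V → Finset (Fin l.length) → Prop
  | [], x, _ => x = pi
  | i :: l, x, A =>
    (hd (n := l.length) A ∧ D.coroot (D.simple i) x = -1 ∧
      Good l (D.act (D.s i) x) (tl (n := l.length) A)) ∨
    (¬ hd (n := l.length) A ∧ Good l x (tl (n := l.length) A))

theorem coroot_combo (k : D.I → ℕ) (i : D.I) :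
    D.coroot (D.simple i) (pi - ∑ j, (k j : ℚ) • D.simple j) =
      D.coroot (D.simple i) pi - ∑ j, (k j : ℚ) * D.coroot (D.simple i) (D.simple j) := by
  simp

theorem exists_suffix_count (i : D.I) (l : List D.I) (n : ℕ) (h : n < l.count i) :
    ∃ m, (i :: m) <:+ l ∧ m.count i = n := by
  induction l with
  | nil => simp at h
  | cons j l ih =>
    by_cases hn : n < l.count i
    · obtain ⟨m, h1, h2⟩ := ih hn
      exact ⟨m, h1.trans (List.suffix_cons _ _), h2⟩
    · rw [List.count_cons] at h
      by_cases hj : j = i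
      · subst hj
        refine ⟨l, List.suffix_rfl, ?_⟩
        simp at h; omega
      · simp [hj] at h; omega

/-- filter condition, in terms of counts -/
def Star (l : List D.I) (k : D.I → ℕ) : Prop :=
  ∀ i m, (i :: m) <:+ l → m.count i = k i →
    ∀ j, j ≠ i → D.coroot (D.simple i) (D.simple j) ≠ 0 → k j ≤ m.count j

theorem star_pairing (l : List D.I) (hl : D.MinW pi l) (k : D.I → ℕ) (hs : D.Star l k)
    (i : D.I) (hi : k i < l.count i) :
    D.coroot (D.simple i) (pi - ∑ j, (k j : ℚ) • D.simple j) ≤ 1 ∧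
    (D.coroot (D.simple i) (pi - ∑ j, (k j : ℚ) • D.simple j) = 1 →
      ∃ m, (i :: m) <:+ l ∧ m.count i = k i ∧
        ∀ j, D.coroot (D.simple i) (D.simple j) ≠ 0 → k j = m.count j) := by
  obtain ⟨m, h1, h2⟩ := D.exists_suffix_count i l (k i) hi
  have hm := D.MinW_suffix pi l _ hl h1
  have h3 := hm.1
  rw [D.MinW_weight pi m hm.2, coroot_combo] at h3
  have h4 : ∀ j ∈ Finset.univ, (k j : ℚ) * D.coroot (D.simple i) (D.simple j) ≥
      ((m.count j : ℕ) : ℚ) * D.coroot (D.simple i) (D.simple j) := by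
    intro j _
    by_cases hj : j = i
    · subst hj; rw [h2]
    by_cases h0 : D.coroot (D.simple i) (D.simple j) = 0
    · simp [h0]
    have h5 : (k j : ℚ) ≤ (m.count j : ℕ) := by exact_mod_cast hs i m h1 h2 j hj h0
    nlinarith [D.cartan_nonpos i j hj]
  have h5 := Finset.sum_le_sum h4
  rw [coroot_combo]
  refine ⟨by linarith, fun h6 => ⟨m, h1, h2, fun j hj => ?_⟩⟩
  have h7 : ∑ j, ((m.count j : ℕ) : ℚ) * D.coroot (D.simple i) (D.simple j) =
      ∑ j, (k j : ℚ) * D.coroot (D.simple i) (D.simple j) := by linarith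
  have h8 := (Finset.sum_eq_sum_iff_of_le h4).mp h7 j (Finset.mem_univ _)
  have := mul_right_cancel₀ hj h8
  exact_mod_cast this.symm

theorem Star_cons (l : List D.I) (k : D.I → ℕ) (i : D.I) (hk : ∀ j, k j ≤ l.count j)
    (hs : D.Star l k) : D.Star (i :: l) k := by
  intro j m hm hc g hg hg'
  rcases List.suffix_cons_iff.mp hm with h | h
  · obtain ⟨rfl, rfl⟩ := List.cons.inj h
    exact hk g
  · exact hs j m h hc g hg hg'

theorem good_star (l : List D.I) (hl : D.MinW pi l) : ∀ (x : D.V) (A : Finset (Fin l.length)),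
    D.Good pi l x A → ∃ k : D.I → ℕ, x = pi - ∑ j, (k j : ℚ) • D.simple j ∧
      (∀ j, k j ≤ l.count j) ∧ D.Star l k := by
  induction l with
  | nil =>
    intro x A h
    have h' : x = pi := h
    refine ⟨fun _ => 0, by simpa using h', by simp, ?_⟩
    intro i m hm
    simp at hm
  | cons i l ih =>
    rintro x A (⟨_, hx, hg⟩ | ⟨_, hg⟩)
    · obtain ⟨k, h1, h2, h3⟩ := ih hl.2 _ _ hg
      have h3' := D.Star_cons l k i h2 h3
      have hp : D.coroot (D.simple i) (pi - ∑ j, (k j : ℚ) • D.simple j) = 1 := by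
        rw [← h1, coroot_act_s, coroot_simple_self, hx]; norm_num
      obtain ⟨m, hm1, hm2, hm3⟩ := (D.star_pairing pi (i :: l) hl k h3' i
        (by rw [List.count_cons_self]; exact Nat.lt_succ_of_le (h2 i))).2 hp
      refine ⟨fun j => k j + if j = i then 1 else 0, ?_, ?_, ?_⟩
      · have : x = D.act (D.s i) (D.act (D.s i) x) := (D.act_s_s i x).symm
        rw [this, h1, act_s, hp]
        have e : ∀ j, ((k j + (if j = i then 1 else 0) : ℕ) : ℚ) • D.simple j =
          (k j : ℚ) • D.simple j + (if j = i then (1:ℚ) else 0) • D.simple j := by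
          intro j; split_ifs <;> simp [add_smul]
        simp only [e, Finset.sum_add_distrib]
        simp
        abel
      · intro j
        have := h2 j
        rw [List.count_cons]
        by_cases hj : j = i
        · subst hj; simpa using this
        · simp [hj]; omega
      · intro j n hn hc g hgj hgc
        by_cases hj : j = i
        · subst hj
          simp only [if_true] at hc
          simp only [if_neg hgj, add_zero]
          have hs : m <:+ n := by
            rcases List.suffix_or_suffix_of_suffix ((List.suffix_cons j m).trans hm1)
              ((List.suffix_cons j n).trans hn) with h | h
            · exact h
            · have := h.sublist.count_le j
              omega
          rw [hm3 g hgc]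
          exact hs.sublist.count_le g
        · simp only [if_neg hj, add_zero] at hc
          by_cases hgi : g = i
          · subst hgi
            simp only [if_true]
            have hji : D.coroot (D.simple g) (D.simple j) ≠ 0 :=
              fun h0 => hgc (D.cartan_zero_symm _ _ h0)
            have hc2 := hm3 j hji
            have hs : (g :: m) <:+ n := by
              rcases List.suffix_or_suffix_of_suffix hm1 hn with h | h
              · rcases List.suffix_cons_iff.mp h with h' | h'
                · exact absurd (List.cons.inj h').1.symm hj
                · exact h'
              · rcases List.suffix_cons_iff.mp h with h' | h'
                · exact absurd (List.cons.inj h').1 hj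
                · have := h'.sublist.count_le j
                  simp at this; omega
            have := hs.sublist.count_le g
            simp at this
            omega
          · simp only [if_neg hgi, add_zero]
            exact h3' j n hn hc g hgj hgc
    · obtain ⟨k, h1, h2, h3⟩ := ih hl.2 _ _ hg
      exact ⟨k, h1, fun j => (h2 j).trans ((List.sublist_cons_self i l).count_le j),
        D.Star_cons l k i h2 h3⟩

theorem good_le_one (i : D.I) (l : List D.I) (hl : D.MinW pi (i :: l)) (x : D.V)
    (A : Finset (Fin l.length)) (h : D.Good pi l x A) : D.coroot (D.simple i) x ≤ 1 := by
  obtain ⟨k, h1, h2, h3⟩ := D.good_star pi l hl.2 x A h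
  rw [h1]
  exact (D.star_pairing pi (i :: l) hl k (D.Star_cons l k i h2 h3) i
        (by rw [List.count_cons_self]; exact Nat.lt_succ_of_le (h2 i))).1

/-- localization sum -/
noncomputable def X (φ : D.V →ₗ[ℚ] ℚ) (l : List D.I) (x : D.V) : ℚ :=
  ∑ A : Finset (Fin l.length), if D.Good pi l x A then ∏ j ∈ A, φ (D.refRoot l j) else 0

theorem refRoot_zero (i : D.I) (l : List D.I) :
    D.refRoot (i :: l) (0 : Fin (l.length + 1)) = D.simple i := by
  simp [refRoot, wordProd]

theorem refRoot_succ (i : D.I) (l : List D.I) (j : Fin l.length) :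
    D.refRoot (i :: l) j.succ = D.act (D.s i) (D.refRoot l j) := by
  simp [refRoot, wordProd]

theorem X_nil (φ : D.V →ₗ[ℚ] ℚ) (x : D.V) : D.X pi φ [] x = if x = pi then 1 else 0 := by
  unfold X
  rw [Fintype.sum_eq_single (∅ : Finset (Fin ([] : List D.I).length))]
  · by_cases h : x = pi
    · rw [if_pos h, if_pos (show D.Good pi [] x ∅ from h)]; simp
    · rw [if_neg h, if_neg (show ¬ D.Good pi [] x ∅ from h)]
  · intro A hA
    exact absurd (Finset.eq_empty_of_forall_notMem fun j => j.elim0) hA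

theorem good_cons_up (i : D.I) (l : List D.I) (x : D.V) (A : Finset (Fin l.length)) :
    D.Good pi (i :: l) x (up A) ↔ D.Good pi l x A := by
  simp only [Good, tl_up]
  have : ¬ hd (up A) := zero_mem_up A
  simp [this]

theorem good_cons_insert (i : D.I) (l : List D.I) (x : D.V) (A : Finset (Fin l.length)) :
    D.Good pi (i :: l) x (insert (0 : Fin (l.length + 1)) (up A)) ↔
      D.coroot (D.simple i) x = -1 ∧ D.Good pi l (D.act (D.s i) x) A := by
  simp only [Good, tl_insert_up]
  have : hd (insert 0 (up A)) := Finset.mem_insert_self _ _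
  simp [this]

theorem prod_up (φ : D.V →ₗ[ℚ] ℚ) (i : D.I) (l : List D.I) (A : Finset (Fin l.length)) :
    ∏ j ∈ up A, φ (D.refRoot (i :: l) j) =
      ∏ j ∈ A, (φ ∘ₗ (D.act (D.s i) : D.V →ₗ[ℚ] D.V)) (D.refRoot l j) := by
  unfold up
  rw [Finset.prod_map]
  refine Finset.prod_congr rfl fun j _ => ?_
  have := D.refRoot_succ i l j
  simp only [Fin.coe_succEmb, LinearMap.comp_apply, LinearEquiv.coe_coe]
  rw [← this]

theorem X_cons (φ : D.V →ₗ[ℚ] ℚ) (i : D.I) (l : List D.I) (x : D.V) :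
    D.X pi φ (i :: l) x = D.X pi (φ ∘ₗ (D.act (D.s i) : D.V →ₗ[ℚ] D.V)) l x +
      if D.coroot (D.simple i) x = -1 then
        φ (D.simple i) * D.X pi (φ ∘ₗ (D.act (D.s i) : D.V →ₗ[ℚ] D.V)) l (D.act (D.s i) x)
      else 0 := by
  unfold X
  refine (sum_finset_succ (n := l.length) _).trans ?_
  congr 1
  · refine Finset.sum_congr rfl fun A _ => ?_
    exact if_congr (D.good_cons_up pi i l x A) (D.prod_up φ i l A) rfl
  · split_ifs with hx
    · rw [Finset.mul_sum]
      refine Finset.sum_congr rfl fun A _ => ?_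
      rw [mul_ite, mul_zero]
      refine if_congr ((D.good_cons_insert pi i l x A).trans (by simp [hx])) ?_ rfl
      refine (Finset.prod_insert (zero_mem_up A)).trans ?_
      have := D.refRoot_zero i l
      rw [← D.prod_up φ i l A]
      exact congrArg (fun z => φ z * _) this
    · refine Finset.sum_eq_zero fun A _ => if_neg ?_
      intro h
      exact hx ((D.good_cons_insert pi i l x A).mp h).1

theorem X_zero (φ : D.V →ₗ[ℚ] ℚ) (i : D.I) (l : List D.I) (hl : D.MinW pi (i :: l)) (x : D.V)
    (hx : 1 < D.coroot (D.simple i) x) : D.X pi φ l x = 0 := by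
  unfold X
  refine Finset.sum_eq_zero fun A _ => if_neg fun h => ?_
  linarith [D.good_le_one pi i l hl x A h]

end Good
end WeylSetting
namespace WeylSetting
section Chevalley
variable (D : WeylSetting) (pi : D.V)

theorem int_cases (x : D.V) (hx : D.IsPreDominant x) (i : D.I) :
    D.coroot (D.simple i) x = -1 ∨ D.coroot (D.simple i) x = 0 ∨ D.coroot (D.simple i) x = 1 ∨
      1 < D.coroot (D.simple i) x := by
  obtain ⟨n, hn⟩ := hx.1 _ (D.isPosRoot_simple i)
  have h := hx.2 _ (D.isPosRoot_simple i)
  rw [hn] at h ⊢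
  have h' : (-1 : ℤ) ≤ n := by exact_mod_cast h
  by_cases h2 : 1 < n
  · right; right; right; exact_mod_cast h2
  · have : n = -1 ∨ n = 0 ∨ n = 1 := by omega
    rcases this with rfl | rfl | rfl <;> simp

theorem chevalley (hpi : D.IsDominant pi) (l : List D.I) (hl : D.MinW pi l) :
    ∀ (φ : D.V →ₗ[ℚ] ℚ) (x : D.V), D.IsPreDominant x →
    φ (x - D.act (D.wordProd l) pi) * D.X pi φ l x =
      ∑ j, if D.coroot (D.simple j) x = 1 then D.X pi φ l (D.act (D.s j) x) else 0 := by
  induction l with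
  | nil =>
    intro φ x hx
    rw [wordProd_nil, act_one', X_nil]
    have h1 : φ (x - pi) * (if x = pi then (1:ℚ) else 0) = 0 := by
      split_ifs with h
      · simp [h]
      · simp
    rw [h1]
    symm
    refine Finset.sum_eq_zero fun j _ => ?_
    split_ifs with h
    · rw [X_nil, if_neg]
      intro h2
      have h3 := hpi.2 j
      rw [← h2, coroot_act_s, coroot_simple_self, h] at h3
      norm_num at h3
    · rfl
  | cons i l ih =>
    intro φ x hx
    set ψ : D.V →ₗ[ℚ] ℚ := φ ∘ₗ (D.act (D.s i) : D.V →ₗ[ℚ] D.V) with hψ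
    have hψa : ∀ y, φ (D.act (D.s i) y) = ψ y := fun y => rfl
    have hψb : ∀ y, φ y = ψ (D.act (D.s i) y) := fun y => by rw [← hψa, act_s_s]
    have hIH := ih hl.2 ψ
    have hX := D.X_cons pi φ i l
    rw [← hψ] at hX
    set a := φ (D.simple i) with ha
    have hψi : ψ (D.simple i) = - a := by
      rw [← hψa, act_s, coroot_simple_self, ha]
      rw [map_sub, map_smul, smul_eq_mul]; ring
    set c := D.coroot (D.simple i) x with hc
    have e1 : φ (x - D.act (D.wordProd (i :: l)) pi) =
        ψ (x - D.act (D.wordProd l) pi) + c * a := by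
      rw [hψb, wordProd_cons, act_mul', map_sub, act_s_s, act_s, ← hc]
      simp only [map_sub, map_smul, hψi, smul_eq_mul]; ring
    -- the right-hand side
    have e2 : (∑ j, if D.coroot (D.simple j) x = 1 then D.X pi φ (i :: l) (D.act (D.s j) x) else 0)
        = (∑ j, if D.coroot (D.simple j) x = 1 then D.X pi ψ l (D.act (D.s j) x) else 0) +
          a * ∑ j, (if D.coroot (D.simple j) x = 1 ∧
            D.coroot (D.simple i) (D.act (D.s j) x) = -1 then
              D.X pi ψ l (D.act (D.s i) (D.act (D.s j) x)) else 0) := by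
      rw [Finset.mul_sum, ← Finset.sum_add_distrib]
      refine Finset.sum_congr rfl fun j _ => ?_
      by_cases h1 : D.coroot (D.simple j) x = 1
      · rw [if_pos h1, if_pos h1, hX]
        by_cases h2 : D.coroot (D.simple i) (D.act (D.s j) x) = -1
        · rw [if_pos h2, if_pos ⟨h1, h2⟩]
        · rw [if_neg h2, if_neg (fun h => h2 h.2), mul_zero]
      · rw [if_neg h1, if_neg h1, if_neg (fun h => h1 h.1)]; ring
    rw [e2, hX]
    by_cases hcn : c = -1
    · -- descent
      rw [if_pos (hc ▸ hcn)]
      have hpre := D.pre_step x hx i (by rw [← hc, hcn]; norm_num)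
      have e3 := hIH x hx
      have e4 := hIH _ hpre
      have e5 : φ (x - D.act (D.wordProd (i :: l)) pi) =
        ψ (D.act (D.s i) x - D.act (D.wordProd l) pi) := by
        rw [hψb, wordProd_cons, act_mul', map_sub, act_s_s]
      rw [mul_add]
      nth_rewrite 1 [e1]
      rw [e5, add_mul, e3]
      have e6 : ψ (D.act (D.s i) x - D.act (D.wordProd l) pi) *
        (a * D.X pi ψ l (D.act (D.s i) x)) = a *
          ∑ j, if D.coroot (D.simple j) (D.act (D.s i) x) = 1 then
            D.X pi ψ l (D.act (D.s j) (D.act (D.s i) x)) else 0 := by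
        rw [← e4]; ring
      rw [e6, hcn]
      have e7 : (∑ j, if D.coroot (D.simple j) (D.act (D.s i) x) = 1 then
            D.X pi ψ l (D.act (D.s j) (D.act (D.s i) x)) else 0) =
          (∑ j, (if D.coroot (D.simple j) x = 1 ∧
            D.coroot (D.simple i) (D.act (D.s j) x) = -1 then
              D.X pi ψ l (D.act (D.s i) (D.act (D.s j) x)) else 0)) + D.X pi ψ l x := by
        have hsingle : D.X pi ψ l x = ∑ j, if j = i then D.X pi ψ l x else 0 := by simp
        rw [hsingle, ← Finset.sum_add_distrib]
        refine Finset.sum_congr rfl fun j _ => ?_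
        by_cases hji : j = i
        · subst hji
          rw [if_pos rfl, if_pos, if_neg, act_s_s, zero_add]
          · rintro ⟨h, -⟩; rw [← hc, hcn] at h; norm_num at h
          · rw [coroot_act_s, coroot_simple_self, ← hc, hcn]; norm_num
        · rw [if_neg hji, add_zero]
          have h1 := D.coroot_act_s j i x
          have h2 := D.coroot_act_s i j x
          rw [← hc, hcn] at h1 h2
          by_cases hz : D.coroot (D.simple i) (D.simple j) = 0
          · have hz' := D.cartan_zero_symm i j hz
            rw [hz'] at h1
            rw [hz] at h2
            simp only [mul_zero, sub_zero] at h1 h2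
            rw [h1, h2, ← act_mul', ← act_mul', D.commute_of_zero i j hz]
            simp
          · have hz' : D.coroot (D.simple j) (D.simple i) ≠ 0 :=
              fun h => hz (D.cartan_zero_symm j i h)
            rw [if_neg (c := _ ∧ _)]
            · split_ifs with h3
              · apply D.X_zero pi ψ i l hl
                rw [coroot_act_s, h3, coroot_act_s, ← hc, hcn, coroot_simple_self]
                have := lt_of_le_of_ne (D.cartan_nonpos i j hji) hz
                linarith
              · rfl
            · rintro ⟨h3, h4⟩
              rw [h2, h3] at h4
              apply hz; linarith
      rw [e7]; ring
    · rw [if_neg (hc ▸ hcn), add_zero, e1, add_mul, hIH x hx]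
      congr 1
      have hcn0 : 0 ≤ c := by
        rcases D.int_cases x hx i with h | h | h | h
        · exact absurd h hcn
        all_goals (rw [← hc] at h; linarith)
      rw [mul_comm c a, mul_assoc]
      congr 1
      rw [Finset.sum_eq_single i]
      · rw [act_s_s]
        rcases D.int_cases x hx i with h | h | h | h
        · exact absurd h hcn
        · rw [← hc] at h
          rw [h, if_neg (by rintro ⟨h', -⟩; rw [← hc, h] at h'; norm_num at h'), zero_mul]
        · rw [if_pos, hc, h, one_mul]
          refine ⟨h, ?_⟩
          rw [coroot_act_s, h, coroot_simple_self]; norm_num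
        · rw [D.X_zero pi ψ i l hl x h]; simp
      · intro j _ hji
        apply if_neg
        rintro ⟨h1, h2⟩
        rw [coroot_act_s, h1, ← hc] at h2
        linarith [D.cartan_nonpos i j hji]
      · simp

end Chevalley
end WeylSetting
namespace WeylSetting
section Excited
variable (D : WeylSetting) (pi : D.V)

theorem heapCovers_succ (i : D.I) (l : List D.I) (j k : Fin l.length) :
    D.heapCovers (i :: l) j.succ k.succ ↔ D.heapCovers l j k := by
  simp [heapCovers]

theorem heapLE_pos (l : List D.I) (j k : Fin l.length) (h : D.heapLE l j k) :
    (j : ℕ) ≤ k := by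
  induction h with
  | refl => exact le_rfl
  | tail _ h ih => exact ih.trans h.1.le

theorem heapLT_pos (l : List D.I) (j k : Fin l.length) (h : D.heapLT l j k) :
    (j : ℕ) < k := lt_of_le_of_ne (D.heapLE_pos l j k h.1) fun e => h.2 (Fin.ext e)

theorem heapLE_succ (i : D.I) (l : List D.I) (j k : Fin l.length) :
    D.heapLE (i :: l) j.succ k.succ ↔ D.heapLE l j k := by
  constructor
  · intro h
    have key : ∀ y : Fin (l.length + 1), D.heapLE (i :: l) j.succ y →
        ∃ k : Fin l.length, y = k.succ ∧ D.heapLE l j k := by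
      intro y hy
      induction hy with
      | refl => exact ⟨j, rfl, Relation.ReflTransGen.refl⟩
      | @tail b c _ h2 ih =>
        obtain ⟨k, rfl, hk⟩ := ih
        revert h2
        refine Fin.cases ?_ (fun c => ?_) c
        · intro h2
          exact absurd h2.1 (by simp)
        · intro h2
          exact ⟨c, rfl, hk.tail ((D.heapCovers_succ i l k c).mp h2)⟩
    obtain ⟨k', e, hk⟩ := key _ h
    rw [Fin.succ_inj] at e
    rwa [e]
  · intro h
    exact Relation.ReflTransGen.lift (fun j : Fin l.length => (j.succ : Fin (l.length + 1)))
      (fun a b hab => (D.heapCovers_succ i l a b).mpr hab) _ _ h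

theorem heapLT_succ (i : D.I) (l : List D.I) (j k : Fin l.length) :
    D.heapLT (i :: l) j.succ k.succ ↔ D.heapLT l j k := by
  unfold heapLT
  have := D.heapLE_succ i l j k
  constructor
  · rintro ⟨h, h'⟩; exact ⟨this.mp h, fun e => h' (by rw [e])⟩
  · rintro ⟨h, h'⟩; exact ⟨this.mpr h, fun e => h' (Fin.succ_inj.mp e)⟩

theorem pairing_neg (i : D.I) (l : List D.I) (hl : D.MinW pi l) (q : Fin l.length)
    (hq : l.get q = i)
    (h : ∀ u : Fin l.length, (u : ℕ) < q → l.get u ≠ i →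
      D.coroot (D.simple i) (D.simple (l.get u)) = 0) :
    D.coroot (D.simple i) (D.act (D.wordProd l) pi) = -1 := by
  induction l with
  | nil => exact q.elim0
  | cons j l ih =>
    rw [wordProd_cons, act_mul', coroot_act_s, hl.1]
    revert hq h
    refine Fin.cases ?_ (fun q => ?_) q
    · intro hq h
      have e : j = i := hq
      subst e
      rw [hl.1, coroot_simple_self]; norm_num
    · intro hq h
      have h1 := ih hl.2 q hq fun u hu hui => h u.succ (by simpa using hu) hui
      by_cases e : j = i
      · subst e
        have := hl.1
        rw [h1] at this; norm_num at this
      · have h2 := h ⟨0, by simp⟩ (by simp) e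
        have h3 : D.coroot (D.simple i) (D.simple j) = 0 := h2
        rw [h1, h3]; norm_num

theorem same_color_lt (l : List D.I) (hl : D.MinW pi l) : ∀ (p q : Fin l.length),
    (p : ℕ) < q → l.get p = l.get q → D.heapLT l p q := by
  induction l with
  | nil => intro p; exact p.elim0
  | cons i l ih =>
    intro p q
    refine Fin.cases (n := l.length) ?_ (fun q => ?_) q
    · intro h; simp at h
    refine Fin.cases (n := l.length) ?_ (fun p => ?_) p
    · intro _ he
      have he' : i = l.get q := he
      have hex : ∃ u : Fin l.length, (u : ℕ) < q ∧ l.get u ≠ i ∧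
          D.coroot (D.simple i) (D.simple (l.get u)) ≠ 0 := by
        by_contra hne
        push Not at hne
        have h1 := D.pairing_neg pi i l hl.2 q he'.symm hne
        rw [hl.1] at h1; norm_num at h1
      obtain ⟨u, hu1, hu2, hu3⟩ := hex
      refine ⟨Relation.ReflTransGen.head (b := (u.succ : Fin (l.length + 1)))
        ?_ (Relation.ReflTransGen.single ?_), fun e => ?_⟩
      · refine ⟨by simp, ?_⟩
        change D.s i * D.s (l.get u) ≠ D.s (l.get u) * D.s i
        exact (D.ncomm_iff _ _).mpr ⟨hu2.symm, hu3⟩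
      · refine ⟨by simpa using hu1, ?_⟩
        change D.s (l.get u) * D.s (l.get q) ≠ D.s (l.get q) * D.s (l.get u)
        rw [← he']
        exact ((D.ncomm_iff _ _).mpr ⟨hu2.symm, hu3⟩).symm
      · exact absurd e (Fin.succ_ne_zero q).symm
    · intro h he
      exact (D.heapLT_succ i l p q).mpr (ih hl.2 p q (by simpa using h) he)

theorem tl_erase_succ {n : ℕ} (A : Finset (Fin (n + 1))) (q : Fin n) :
    tl (A.erase q.succ) = (tl A).erase q := by
  ext j; simp [mem_tl]

theorem tl_erase_zero {n : ℕ} (A : Finset (Fin (n + 1))) : tl (A.erase 0) = tl A := by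
  ext j; simp [mem_tl, Fin.succ_ne_zero]

theorem hd_erase_succ {n : ℕ} (A : Finset (Fin (n + 1))) (q : Fin n) :
    hd (A.erase q.succ) ↔ hd A := by
  simp [hd, (Fin.succ_ne_zero q).symm]

theorem not_hd_erase_zero {n : ℕ} (A : Finset (Fin (n + 1))) : ¬ hd (A.erase 0) := by
  simp [hd]

theorem good_remove (i : D.I) (l : List D.I) : ∀ (x : D.V) (A : Finset (Fin l.length))
    (q : Fin l.length), D.Good pi l x A → q ∈ A → l.get q = i →
    (∀ u ∈ A, (u : ℕ) < q → D.coroot (D.simple i) (D.simple (l.get u)) = 0) →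
    D.coroot (D.simple i) x = -1 ∧ D.Good pi l (D.act (D.s i) x) (A.erase q) := by
  induction l with
  | nil => intro x A q; exact q.elim0
  | cons j l ih =>
    intro x A q
    refine Fin.cases (n := l.length) ?_ (fun q => ?_) q
    · intro hg hq he _
      have he' : j = i := he
      subst he'
      rcases hg with ⟨_, h1, h2⟩ | ⟨h1, _⟩
      · refine ⟨h1, Or.inr ⟨not_hd_erase_zero (n := l.length) A, ?_⟩⟩
        have e := tl_erase_zero (n := l.length) A
        exact e.symm ▸ h2
      · exact absurd hq h1
    · intro hg hq he hu
      have hu' : ∀ u ∈ tl (n := l.length) A, (u : ℕ) < q →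
          D.coroot (D.simple i) (D.simple (l.get u)) = 0 := by
        intro u hu1 hu2
        exact hu u.succ ((mem_tl _ _).mp hu1) (by simpa using hu2)
      have hq' : q ∈ tl (n := l.length) A := (mem_tl _ _).mpr hq
      have e := tl_erase_succ (n := l.length) A q
      have eh := hd_erase_succ (n := l.length) A q
      rcases hg with ⟨h0, h1, h2⟩ | ⟨h0, h2⟩
      · obtain ⟨h3, h4⟩ := ih _ _ q h2 hq' he hu'
        have hz : D.coroot (D.simple i) (D.simple j) = 0 := hu _ h0 (by simp)
        have hz' := D.cartan_zero_symm i j hz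
        rw [coroot_act_s, hz, mul_zero, sub_zero] at h3
        refine ⟨h3, Or.inl ⟨eh.mpr h0, ?_, ?_⟩⟩
        · rw [coroot_act_s, hz', mul_zero, sub_zero, h1]
        · rw [← act_mul', D.commute_of_zero i j hz, act_mul'] at h4
          exact e.symm ▸ h4
      · obtain ⟨h3, h4⟩ := ih _ _ q h2 hq' he hu'
        exact ⟨h3, Or.inr ⟨fun h => h0 (eh.mp h), e.symm ▸ h4⟩⟩

theorem good_pre (hpi : D.IsDominant pi) (l : List D.I) : ∀ (x : D.V) (A : Finset (Fin l.length)),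
    D.Good pi l x A → D.IsPreDominant x := by
  induction l with
  | nil =>
    intro x A h
    have h' : x = pi := h
    rw [h']; exact D.dom_pre pi hpi
  | cons i l ih =>
    rintro x A (⟨_, h1, h2⟩ | ⟨_, h2⟩)
    · have := D.pre_step _ (ih _ _ h2) i (by
        rw [coroot_act_s, h1, coroot_simple_self]; norm_num)
      rwa [act_s_s] at this
    · exact ih _ _ h2

theorem good_descent (hpi : D.IsDominant pi) (i : D.I) (l : List D.I) :
    ∀ (x : D.V) (A : Finset (Fin l.length)),
    D.Good pi l x A → D.coroot (D.simple i) x = -1 →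
    ∃ q ∈ A, l.get q = i ∧
      ∀ u ∈ A, (u : ℕ) < q → D.coroot (D.simple i) (D.simple (l.get u)) = 0 := by
  induction l with
  | nil =>
    intro x A h h1
    have h' : x = pi := h
    have := hpi.2 i
    rw [← h', h1] at this; norm_num at this
  | cons j l ih =>
    have lift : ∀ (A : Finset (Fin (l.length + 1))),
        (hd A → D.coroot (D.simple i) (D.simple j) = 0) →
        (∃ q ∈ tl A, l.get q = i ∧
          ∀ u ∈ tl A, (u : ℕ) < q → D.coroot (D.simple i) (D.simple (l.get u)) = 0) →
        ∃ q : Fin (l.length + 1), q ∈ A ∧ (j :: l).get q = i ∧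
          ∀ u : Fin (l.length + 1), u ∈ A → (u : ℕ) < q →
            D.coroot (D.simple i) (D.simple ((j :: l).get u)) = 0 := by
      rintro A h0 ⟨q, h1, h2, h3⟩
      refine ⟨q.succ, (mem_tl _ _).mp h1, h2, fun u => ?_⟩
      refine Fin.cases ?_ (fun u => ?_) u
      · intro h _; exact h0 h
      · intro hu hlt
        exact h3 u ((mem_tl _ _).mpr hu) (by simpa using hlt)
    rintro x A (⟨h0, h1, h2⟩ | ⟨h0, h2⟩) hx
    · by_cases hji : j = i
      · subst hji
        refine ⟨⟨0, by simp⟩, h0, rfl, fun u _ hu => absurd hu (by simp)⟩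
      · have h3 := (D.good_pre pi hpi l _ _ h2).2 _ (D.isPosRoot_simple i)
        have h4 := D.cartan_nonpos i j hji
        have h5 : D.coroot (D.simple i) (D.simple j) = 0 := by
          rw [coroot_act_s, h1, hx] at h3; linarith
        exact lift A (fun _ => h5) (ih _ _ h2 (by rw [coroot_act_s, hx, h5]; norm_num))
    · exact lift A (fun h => absurd h h0) (ih _ _ h2 hx)

theorem excite_good (l : List D.I) (hl : D.MinW pi l) : ∀ (x : D.V) (A B : Finset (Fin l.length)),
    D.Excite l A B → D.Good pi l x A → D.Good pi l x B := by
  induction l with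
  | nil => rintro x A B ⟨p, _⟩; exact p.elim0
  | cons i l ih =>
    rintro x A B ⟨p, q, hpq, he, hqA, hpB, hAB, hz, hu⟩ hg
    have hlt := D.heapLT_pos _ _ _ hpq
    revert hpq he hqA hpB hAB hz hu hlt
    refine Fin.cases (n := l.length) ?_ (fun q => ?_) q
    · intro _ _ _ _ _ _ _ h; simp at h
    refine Fin.cases (n := l.length) ?_ (fun p => ?_) p
    · intro hpq he hqA hpB hAB hz hu hlt
      have he' : i = l.get q := he
      have hA0 : ¬ hd (n := l.length) A := by
        intro h
        have h1 : (0 : Fin (l.length + 1)) ∈ Finset.erase (α := Fin (l.length + 1)) A q.succ :=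
          Finset.mem_erase.mpr ⟨(Fin.succ_ne_zero q).symm, h⟩
        have h2 : (0 : Fin (l.length + 1)) ∈ Finset.erase (α := Fin (l.length + 1)) B 0 := hAB ▸ h1
        exact (Finset.notMem_erase _ _) h2
      have hB : tl (n := l.length) B = (tl (n := l.length) A).erase q := by
        rw [← tl_erase_zero (n := l.length) B, ← tl_erase_succ (n := l.length) A q]
        exact congrArg (tl (n := l.length)) hAB.symm
      rcases hg with ⟨h, _⟩ | ⟨_, hg⟩
      · exact absurd h hA0
      obtain ⟨h1, h2⟩ := D.good_remove pi i l x _ q hg ((mem_tl _ _).mpr hqA) he'.symm (by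
        intro u huA huq
        by_contra hne
        have huA' : (u.succ : Fin (l.length + 1)) ∈ A := (mem_tl _ _).mp huA
        by_cases hc : l.get u = i
        · refine hz (u.succ : Fin (l.length + 1)) ?_ ?_ hc
          · exact D.same_color_lt pi (i :: l) hl (0 : Fin (l.length + 1))
              (u.succ : Fin (l.length + 1)) (by simp) hc.symm
          · exact D.same_color_lt pi (i :: l) hl (u.succ : Fin (l.length + 1))
              (q.succ : Fin (l.length + 1)) (by simpa using huq) (hc.trans he')
        · have hnc := (D.ncomm_iff i (l.get u)).mpr ⟨fun e => hc e.symm, hne⟩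
          refine hu (u.succ : Fin (l.length + 1)) huA' (Relation.ReflTransGen.single ⟨by simp, hnc⟩)
            (Relation.ReflTransGen.single ⟨by simpa using huq, ?_⟩)
            ⟨fun e => hc e.symm, hnc⟩
          change D.s (l.get u) * D.s (l.get q) ≠ D.s (l.get q) * D.s (l.get u)
          rw [← he']
          exact hnc.symm)
      exact Or.inl ⟨hpB, h1, hB ▸ h2⟩
    · intro hpq he hqA hpB hAB hz hu hlt
      have hhd : hd (n := l.length) A ↔ hd (n := l.length) B := by
        rw [← hd_erase_succ (n := l.length) A q, ← hd_erase_succ (n := l.length) B p]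
        exact Iff.of_eq (congrArg (hd (n := l.length)) hAB)
      have hEx : D.Excite l (tl (n := l.length) A) (tl (n := l.length) B) := by
        refine ⟨p, q, (D.heapLT_succ i l p q).mp hpq, he, (mem_tl _ _).mpr hqA,
          (mem_tl _ _).mpr hpB, ?_, ?_, ?_⟩
        · rw [← tl_erase_succ, ← tl_erase_succ]
          exact congrArg (tl (n := l.length)) hAB
        · intro z h1 h2
          exact hz (z.succ : Fin (l.length + 1)) ((D.heapLT_succ i l p z).mpr h1)
            ((D.heapLT_succ i l z q).mpr h2)
        · intro u h0 h1 h2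
          exact hu (u.succ : Fin (l.length + 1)) ((mem_tl _ _).mp h0)
            ((D.heapLE_succ i l p u).mpr h1) ((D.heapLE_succ i l u q).mpr h2)
      rcases hg with ⟨h0, h1, h2⟩ | ⟨h0, h2⟩
      · exact Or.inl ⟨hhd.mp h0, h1, ih hl.2 _ _ _ hEx h2⟩
      · exact Or.inr ⟨fun h => h0 (hhd.mpr h), ih hl.2 _ _ _ hEx h2⟩

theorem excite_lift (i : D.I) (l : List D.I) (A B : Finset (Fin (l.length + 1)))
    (hAB : hd A ↔ hd B) (h : D.Excite l (tl A) (tl B)) : D.Excite (i :: l) A B := by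
  obtain ⟨p, q, hpq, he, hqA, hpB, hE, hz, hu⟩ := h
  refine ⟨p.succ, q.succ, (D.heapLT_succ i l p q).mpr hpq, he, (mem_tl _ _).mp hqA,
    (mem_tl _ _).mp hpB, ?_, ?_, ?_⟩
  · have h1 : tl (A.erase q.succ) = tl (B.erase p.succ) := by
      rw [tl_erase_succ, tl_erase_succ, hE]
    have h2 : hd (A.erase q.succ) ↔ hd (B.erase p.succ) := by
      rw [hd_erase_succ, hd_erase_succ, hAB]
    have h3 : A.erase q.succ = B.erase p.succ := by
      by_cases h : hd (A.erase q.succ)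
      · rw [eq_insert_up _ h, eq_insert_up _ (h2.mp h), h1]
      · rw [eq_up _ h, eq_up _ (fun h' => h (h2.mpr h')), h1]
    exact h3
  · intro z
    refine Fin.cases (n := l.length) ?_ (fun z => ?_) z
    · intro h _
      exact absurd (D.heapLT_pos _ _ _ h) (by simp)
    · intro h1 h2
      exact hz z ((D.heapLT_succ i l p z).mp h1) ((D.heapLT_succ i l z q).mp h2)
  · intro u
    refine Fin.cases (n := l.length) ?_ (fun u => ?_) u
    · intro _ h _
      exact absurd (D.heapLE_pos _ _ _ h) (by simp)
    · intro h0 h1 h2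
      exact hu u ((mem_tl _ _).mpr h0) ((D.heapLE_succ i l p u).mp h1)
        ((D.heapLE_succ i l u q).mp h2)

theorem inExcited_up (i : D.I) (l : List D.I) (A B : Finset (Fin l.length))
    (h : D.InExcited l A B) : D.InExcited (i :: l) (up A) (up B) :=
  Relation.ReflTransGen.lift (fun A : Finset (Fin l.length) => up A)
    (fun A B hAB => D.excite_lift i l _ _
      (iff_of_false (zero_mem_up A) (zero_mem_up B)) (by rwa [tl_up, tl_up])) _ _ h

theorem inExcited_insert (i : D.I) (l : List D.I) (A B : Finset (Fin l.length))
    (h : D.InExcited l A B) : D.InExcited (i :: l) (insert (0 : Fin (l.length + 1)) (up A))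
      (insert (0 : Fin (l.length + 1)) (up B)) :=
  Relation.ReflTransGen.lift (fun A : Finset (Fin l.length) => insert (0 : Fin (l.length + 1)) (up A))
    (fun A B hAB => D.excite_lift i l _ _
      (iff_of_true (Finset.mem_insert_self _ _) (Finset.mem_insert_self _ _))
      (by rwa [tl_insert_up, tl_insert_up])) _ _ h

theorem chain_down (i : D.I) (l : List D.I) (hl : D.MinW pi l) (F : Finset (Fin l.length))
    (q : Fin l.length) (hq : q ∈ F) (hqi : l.get q = i)
    (hu : ∀ u ∈ F, (u : ℕ) < q → D.coroot (D.simple i) (D.simple (l.get u)) = 0) :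
    ∀ (n : ℕ) (p : Fin l.length), (q : ℕ) - p = n → (p : ℕ) ≤ q → l.get p = i →
      D.InExcited l F (insert p (F.erase q)) := by
  intro n
  induction n using Nat.strong_induction_on with
  | _ n ih =>
    intro p hn hpq hpi
    have hnot : ∀ z : Fin l.length, l.get z = i → (z : ℕ) ≤ q → z ∉ F.erase q := by
      intro z hz hzq hmem
      rw [Finset.mem_erase] at hmem
      have hlt : (z : ℕ) < q := lt_of_le_of_ne hzq fun e => hmem.1 (Fin.ext e)
      have := hu z hmem.2 hlt
      rw [hz, coroot_simple_self] at this
      norm_num at this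
    rcases eq_or_lt_of_le hpq with h | h
    · have : p = q := Fin.ext h
      subst this
      rw [Finset.insert_erase hq]
      exact Relation.ReflTransGen.refl
    · let S : Finset (Fin l.length) := Finset.univ.filter fun z => (p : ℕ) < z ∧ l.get z = i
      have hqS : q ∈ S := by simp only [S, Finset.mem_filter]; exact ⟨Finset.mem_univ _, h, hqi⟩
      have hS : S.Nonempty := ⟨q, hqS⟩
      have hmem := S.min'_mem hS
      have hmin : ∀ z ∈ S, S.min' hS ≤ z := fun z hz => S.min'_le z hz
      set p' := S.min' hS with hp'
      simp only [S, Finset.mem_filter] at hmem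
      obtain ⟨-, hpp', hp'i⟩ := hmem
      have hp'q : (p' : ℕ) ≤ q := hmin q hqS
      refine (ih ((q : ℕ) - p') (by omega) p' rfl hp'q hp'i).tail ?_
      refine ⟨p, p', D.same_color_lt pi l hl p p' hpp' (hpi.trans hp'i.symm), hpi.trans hp'i.symm,
        Finset.mem_insert_self _ _, Finset.mem_insert_self _ _, ?_, ?_, ?_⟩
      · rw [Finset.erase_insert (hnot p' hp'i hp'q), Finset.erase_insert (hnot p hpi hpq)]
      · intro z h1 h2 hzc
        have h3 := D.heapLT_pos _ _ _ h1
        have h4 := D.heapLT_pos _ _ _ h2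
        have h5 : p' ≤ z := hmin z (by
          simp only [S, Finset.mem_filter]; exact ⟨Finset.mem_univ _, h3, hzc.trans hpi⟩)
        have : (p' : ℕ) ≤ z := h5
        omega
      · intro u huA h1 h2 hadj
        rw [adj_iff, hpi] at hadj
        rcases Finset.mem_insert.mp huA with rfl | huF
        · exact hadj.1 hp'i.symm
        · rw [Finset.mem_erase] at huF
          have h3 := D.heapLE_pos _ _ _ h2
          have hne : (u : ℕ) ≠ q := fun e => huF.1 (Fin.ext e)
          exact hadj.2 (hu u huF.2 (by omega))

theorem good_weight (l : List D.I) : ∀ (x : D.V) (A : Finset (Fin l.length)),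
    D.Good pi l x A → x = pi - ∑ j ∈ A, D.simple (l.get j) := by
  induction l with
  | nil =>
    intro x A h
    have h' : x = pi := h
    have : A = ∅ := Finset.eq_empty_of_forall_notMem fun j => j.elim0
    rw [this, h']; simp
  | cons i l ih =>
    have hup : ∀ A : Finset (Fin l.length), ∑ j ∈ up A, D.simple ((i :: l).get j) =
        ∑ j ∈ A, D.simple (l.get j) := by
      intro A; unfold up; rw [Finset.sum_map]; rfl
    rintro x A (⟨h0, h1, h2⟩ | ⟨h0, h2⟩)
    · have h3 := ih _ _ h2
      rw [act_s, h1] at h3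
      have e : ∑ j ∈ A, D.simple ((i :: l).get j) =
          D.simple i + ∑ j ∈ tl (n := l.length) A, D.simple (l.get j) := by
        rw [← hup]
        have := eq_insert_up (n := l.length) A h0
        conv_lhs => rw [this]
        exact Finset.sum_insert (zero_mem_up _)
      rw [e]
      have h4 : x + D.simple i = pi - ∑ j ∈ tl (n := l.length) A, D.simple (l.get j) := by
        rw [← h3]; module
      rw [sub_add_eq_sub_sub_swap, ← h4]; abel
    · have h3 := ih _ _ h2
      have e : ∑ j ∈ A, D.simple ((i :: l).get j) =
          ∑ j ∈ tl (n := l.length) A, D.simple (l.get j) := by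
        rw [← hup]
        have := eq_up (n := l.length) A h0
        conv_lhs => rw [this]
        rfl
      rw [e]; exact h3

theorem good_count (l : List D.I) (x : D.V) (A B : Finset (Fin l.length))
    (hA : D.Good pi l x A) (hB : D.Good pi l x B) (i : D.I) :
    (A.filter fun j => l.get j = i).card = (B.filter fun j => l.get j = i).card := by
  have key : ∀ A : Finset (Fin l.length), ∑ j ∈ A, D.simple (l.get j) =
      ∑ i, (((A.filter fun j => l.get j = i).card : ℕ) : ℚ) • D.simple i := by
    intro A
    rw [← Finset.sum_fiberwise A (fun j => l.get j)]
    refine Finset.sum_congr rfl fun i _ => ?_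
    rw [Finset.sum_congr rfl (g := fun _ => D.simple i)
      (fun j hj => by rw [(Finset.mem_filter.mp hj).2]), Finset.sum_const]
    rw [Nat.cast_smul_eq_nsmul]
  have h1 := D.good_weight pi l x A hA
  have h2 := D.good_weight pi l x B hB
  rw [h1] at h2
  have h3 := sub_right_injective h2
  rw [key, key] at h3
  have := congrFun (D.simple_coeff _ _ h3) i
  exact_mod_cast this

theorem good_excited (hpi : D.IsDominant pi) (l : List D.I) (hl : D.MinW pi l) :
    ∀ (x : D.V) (F A : Finset (Fin l.length)),
    D.IsHeapFilter l F → D.Good pi l x F → D.Good pi l x A → D.InExcited l F A := by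
  induction l with
  | nil =>
    intro x F A _ _ _
    have : F = A := by ext j; exact j.elim0
    rw [this]; exact Relation.ReflTransGen.refl
  | cons i l ih =>
    intro x F A hfil hF hA
    have hfil' : D.IsHeapFilter l (tl (n := l.length) F) := by
      intro j k hj hjk
      exact (mem_tl _ _).mpr (hfil _ _ ((mem_tl _ _).mp hj) ((D.heapLE_succ i l j k).mpr hjk))
    have hcount := D.good_count pi (i :: l) x F A hF hA i
    by_cases hA0 : hd (n := l.length) A
    · have eA := eq_insert_up (n := l.length) A hA0
      have hA' : D.coroot (D.simple i) x = -1 ∧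
          D.Good pi l (D.act (D.s i) x) (tl (n := l.length) A) := by
        rcases hA with h | h
        · exact h.2
        · exact absurd hA0 h.1
      by_cases hF0 : hd (n := l.length) F
      · have eF := eq_insert_up (n := l.length) F hF0
        have hF' : D.Good pi l (D.act (D.s i) x) (tl (n := l.length) F) := by
          rcases hF with h | h
          · exact h.2.2
          · exact absurd hF0 h.1
        rw [eA, eF]
        exact D.inExcited_insert i l _ _ (ih hl.2 _ _ _ hfil' hF' hA'.2)
      · have eF := eq_up (n := l.length) F hF0
        have hF' : D.Good pi l x (tl (n := l.length) F) := by
          rcases hF with h | h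
          · exact absurd h.1 hF0
          · exact h.2
        obtain ⟨q, hq1, hq2, hq3⟩ := D.good_descent pi hpi i l x _ hF' hA'.1
        have hF'' := (D.good_remove pi i l x _ q hF' hq1 hq2 hq3).2
        have hfil'' : D.IsHeapFilter l ((tl (n := l.length) F).erase q) := by
          intro j k hj hjk
          rw [Finset.mem_erase] at hj ⊢
          refine ⟨?_, hfil' j k hj.2 hjk⟩
          rintro rfl
          rcases Relation.ReflTransGen.cases_tail hjk with h | ⟨u, hju, huk⟩
          · exact hj.1 h.symm
          · have huF := hfil' j u hj.2 hju
            have h1 := hq3 u huF huk.1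
            have h2 := huk.2
            rw [hq2] at h2
            exact h2 (D.commute_of_zero _ _ h1).symm
        have h1 := D.inExcited_insert i l _ _ (ih hl.2 _ _ _ hfil'' hF'' hA'.2)
        have h2 := D.chain_down pi i (i :: l) hl F (q.succ : Fin (l.length + 1))
          ((mem_tl _ _).mp hq1) hq2 (by
            intro u
            refine Fin.cases (n := l.length) ?_ (fun u => ?_) u
            · intro h _; exact absurd h hF0
            · intro h h'
              exact hq3 u ((mem_tl _ _).mpr h) (by simpa using h')) _ (0 : Fin (l.length + 1)) rfl
              (by simp) rfl
        rw [eA]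
        refine Relation.ReflTransGen.trans h2 ?_
        have e : Finset.erase (α := Fin (l.length + 1)) F q.succ =
            up ((tl (n := l.length) F).erase q) := by
          rw [← tl_erase_succ]
          exact eq_up _ (fun h => hF0 ((hd_erase_succ (n := l.length) F q).mp h))
        have e' : (insert (0 : Fin (l.length + 1)) (Finset.erase (α := Fin (l.length + 1)) F q.succ)) =
          insert (0 : Fin (l.length + 1)) (up ((tl (n := l.length) F).erase q)) := by rw [e]
        exact e'.symm ▸ h1
    · have eA := eq_up (n := l.length) A hA0
      have hA' : D.Good pi l x (tl (n := l.length) A) := by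
        rcases hA with h | h
        · exact absurd h.1 hA0
        · exact h.2
      have hF0 : ¬ hd (n := l.length) F := by
        intro hF0
        have hlt : (Finset.filter (fun j => (i :: l).get j = i) A).card <
            (Finset.filter (fun j => (i :: l).get j = i) F).card := by
          apply Finset.card_lt_card
          refine Finset.ssubset_iff_subset_ne.mpr ⟨?_, ?_⟩
          · intro z hz
            rw [Finset.mem_filter] at hz ⊢
            refine ⟨hfil (0 : Fin (l.length + 1)) z hF0 ?_, hz.2⟩
            by_cases h0 : (z : ℕ) = 0
            · have : z = (0 : Fin (l.length + 1)) := Fin.ext h0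
              rw [this]; exact Relation.ReflTransGen.refl
            · exact (D.same_color_lt pi (i :: l) hl (0 : Fin (l.length + 1)) z
                (Nat.pos_of_ne_zero h0) hz.2.symm).1
          · intro e
            have : (0 : Fin (l.length + 1)) ∈ Finset.filter (fun j => (i :: l).get j = i) F :=
              Finset.mem_filter.mpr ⟨hF0, rfl⟩
            rw [← e] at this
            exact hA0 (Finset.mem_filter.mp this).1
        omega
      have eF := eq_up (n := l.length) F hF0
      have hF' : D.Good pi l x (tl (n := l.length) F) := by
        rcases hF with h | h
        · exact absurd h.1 hF0
        · exact h.2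
      rw [eA, eF]
      exact D.inExcited_up i l _ _ (ih hl.2 _ _ _ hfil' hF' hA')

theorem excited_iff (hpi : D.IsDominant pi) (l : List D.I) (hl : D.MinW pi l)
    (x : D.V) (F : Finset (Fin l.length)) (hfil : D.IsHeapFilter l F) (hF : D.Good pi l x F)
    (A : Finset (Fin l.length)) : D.InExcited l F A ↔ D.Good pi l x A := by
  constructor
  · intro h
    induction h with
    | refl => exact hF
    | tail _ h ih => exact D.excite_good pi l hl x _ _ h ih
  · exact D.good_excited pi hpi l hl x F A hfil hF

end Excited
end WeylSetting
namespace WeylSetting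
section Final
variable (D : WeylSetting) (pi : D.V)

theorem subwordF_cons (i : D.I) (l : List D.I) (A : Finset (Fin (l.length + 1))) :
    D.subwordF (i :: l) A =
      if hd A then i :: D.subwordF l (tl A) else D.subwordF l (tl A) := by
  unfold subwordF
  have h2 : ((List.finRange l.length).map Fin.succ |>.filter fun j => j ∈ A) =
      ((List.finRange l.length).filter fun j => j ∈ tl A).map Fin.succ := by
    rw [List.filter_map]
    congr 1
    apply List.filter_congr
    intro j _
    simp [mem_tl]
  have h1 : List.finRange (i :: l).length = (0 : Fin (l.length + 1)) ::
      (List.finRange l.length).map Fin.succ := List.finRange_succ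
  rw [h1]
  by_cases h : hd A
  · have h' : (0 : Fin (l.length + 1)) ∈ A := h
    rw [if_pos h]
    rw [List.filter_cons_of_pos (by simpa using h')]
    refine congrArg (List.cons i) ((congrArg (List.map (i :: l).get) h2).trans ?_)
    rw [List.map_map]
    rfl
  · have h' : (0 : Fin (l.length + 1)) ∉ A := h
    rw [if_neg h]
    rw [List.filter_cons_of_neg (by simpa using h')]
    refine (congrArg (List.map (i :: l).get) h2).trans ?_
    rw [List.map_map]
    rfl

theorem good_subword (l : List D.I) : ∀ A : Finset (Fin l.length),
    D.MinW pi (D.subwordF l A) → D.Good pi l (D.act (D.wordProd (D.subwordF l A)) pi) A := by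
  induction l with
  | nil => intro A _; simp [Good, subwordF, wordProd]
  | cons i l ih =>
    intro A h
    have e := D.subwordF_cons i l A
    rw [e] at h ⊢
    by_cases h0 : hd (n := l.length) A
    · rw [if_pos h0] at h ⊢
      refine Or.inl ⟨h0, ?_, ?_⟩
      · rw [wordProd_cons, act_mul', coroot_act_s, h.1, coroot_simple_self]; norm_num
      · rw [wordProd_cons, act_mul', act_s_s]; exact ih _ h.2
    · rw [if_neg h0] at h ⊢
      exact Or.inr ⟨h0, ih _ h⟩

theorem subwordF_length (l : List D.I) (A : Finset (Fin l.length)) :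
    (D.subwordF l A).length = A.card := by
  unfold subwordF
  rw [List.length_map, ← List.toFinset_card_of_nodup ((List.nodup_finRange _).filter _)]
  congr 1
  ext j; simp

theorem subwordF_univ (l : List D.I) : D.subwordF l Finset.univ = l := by
  unfold subwordF
  simp

theorem good_univ (l : List D.I) (hl : D.MinW pi l) :
    D.Good pi l (D.act (D.wordProd l) pi) Finset.univ := by
  have := D.good_subword pi l Finset.univ (by rwa [subwordF_univ])
  rwa [subwordF_univ] at this

/-- minuscule paths of length `n` from the weight `x` to the weight `mu` -/
noncomputable def S (mu : D.V) : ℕ → D.V → Finset (List D.I)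
  | 0, x => if x = mu then {[]} else ∅
  | n + 1, x => Finset.univ.biUnion fun j =>
      if D.coroot (D.simple j) x = 1 then (S mu n (D.act (D.s j) x)).image (List.cons j) else ∅

theorem S_card (mu : D.V) (n : ℕ) (x : D.V) : ((D.S mu (n + 1) x).card : ℚ) =
    ∑ j, if D.coroot (D.simple j) x = 1 then ((D.S mu n (D.act (D.s j) x)).card : ℚ) else 0 := by
  rw [S, Finset.card_biUnion]
  · push_cast
    refine Finset.sum_congr rfl fun j _ => ?_
    split_ifs
    · rw [Finset.card_image_of_injective _ List.cons_injective]
    · simp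
  · intro j _ k _ hjk
    refine Finset.disjoint_left.mpr ?_
    intro m hm hm'
    beta_reduce at hm hm'
    split_ifs at hm hm' with h1 h2
    · obtain ⟨a, _, rfl⟩ := Finset.mem_image.mp hm
      obtain ⟨b, _, hb⟩ := Finset.mem_image.mp hm'
      exact hjk (List.cons.inj hb).1.symm
    all_goals simp_all

theorem mem_S (mu : D.V) (n : ℕ) : ∀ (lv m : List D.I), D.MinW pi lv →
    (m ∈ D.S mu n (D.act (D.wordProd lv) pi) ↔ m.length = n ∧ D.MinW pi (m.reverse ++ lv) ∧
      D.act (D.wordProd (m.reverse ++ lv)) pi = mu) := by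
  induction n with
  | zero =>
    intro lv m h
    rw [S]
    constructor
    · intro hm
      split_ifs at hm with h1
      · rw [Finset.mem_singleton] at hm
        subst hm
        exact ⟨rfl, by simpa using h, by simpa using h1⟩
      · simp at hm
    · rintro ⟨h1, h2, h3⟩
      rw [List.length_eq_zero_iff] at h1
      subst h1
      rw [if_pos (by simpa using h3)]
      simp
  | succ n ih =>
    intro lv m h
    rw [S, Finset.mem_biUnion]
    constructor
    · rintro ⟨j, _, hm⟩
      split_ifs at hm with h1
      · obtain ⟨a, ha, rfl⟩ := Finset.mem_image.mp hm
        rw [← act_mul', ← wordProd_cons, ih (j :: lv) a ⟨h1, h⟩] at ha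
        simpa using ha
      · simp at hm
    · rintro ⟨h1, h2, h3⟩
      cases m with
      | nil => simp at h1
      | cons j m =>
        have e : (j :: m).reverse ++ lv = m.reverse ++ j :: lv := by simp
        rw [e] at h2 h3
        have h4 : D.MinW pi (j :: lv) := D.MinW_suffix pi _ _ h2 ⟨_, rfl⟩
        refine ⟨j, Finset.mem_univ _, ?_⟩
        rw [if_pos h4.1, Finset.mem_image]
        refine ⟨m, ?_, rfl⟩
        rw [← act_mul', ← wordProd_cons, ih (j :: lv) m h4]
        exact ⟨by simpa using h1, h2, h3⟩

theorem good_phi (φ : D.V →ₗ[ℚ] ℚ) (hφ : ∀ i, φ (D.simple i) = 1) (l : List D.I) (x : D.V)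
    (A : Finset (Fin l.length)) (h : D.Good pi l x A) : φ (pi - x) = A.card := by
  rw [D.good_weight pi l x A h, sub_sub_cancel, map_sum]
  simp [hφ]

theorem count (hpi : D.IsDominant pi) (φ : D.V →ₗ[ℚ] ℚ) (hφ : ∀ i, φ (D.simple i) = 1)
    (l : List D.I) (hl : D.MinW pi l) (n : ℕ) : ∀ x : D.V, D.IsPreDominant x →
    φ (x - D.act (D.wordProd l) pi) = n →
    ((D.S (D.act (D.wordProd l) pi) n x).card : ℚ) * ∏ j, φ (D.refRoot l j) =
      n.factorial * D.X pi φ l x := by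
  have hL := D.MinW_ht φ hφ pi l hl
  induction n with
  | zero =>
    intro x hx hn
    have hA : ∀ A, D.Good pi l x A → A = Finset.univ := by
      intro A hA
      have h1 := D.good_phi pi φ hφ l x A hA
      rw [← Finset.card_eq_iff_eq_univ, Fintype.card_fin]
      have : (A.card : ℚ) = l.length := by
        rw [← h1, ← hL]
        simp only [map_sub] at *
        push_cast at hn
        linarith
      exact_mod_cast this
    have hX : D.X pi φ l x = if x = D.act (D.wordProd l) pi then ∏ j, φ (D.refRoot l j) else 0 := by
      unfold X
      rw [Fintype.sum_eq_single Finset.univ]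
      · by_cases h : x = D.act (D.wordProd l) pi
        · rw [if_pos h, if_pos (h ▸ D.good_univ pi l hl)]
        · rw [if_neg h, if_neg]
          intro hg
          apply h
          rw [D.good_weight pi l x _ hg, D.good_weight pi l _ _ (D.good_univ pi l hl)]
      · intro A hne
        exact if_neg fun h => hne (hA A h)
    rw [hX, S]
    by_cases h : x = D.act (D.wordProd l) pi
    · rw [if_pos h, if_pos h]; simp
    · rw [if_neg h, if_neg h]; simp
  | succ n ih =>
    intro x hx hn
    have hch := D.chevalley pi hpi l hl φ x hx
    rw [hn] at hch
    rw [Nat.factorial_succ, S_card]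
    have : ((n + 1) * n.factorial : ℕ) * D.X pi φ l x =
        n.factorial * (((n + 1 : ℕ) : ℚ) * D.X pi φ l x) := by push_cast; ring
    rw [this, hch, Finset.sum_mul, Finset.mul_sum]
    refine Finset.sum_congr rfl fun j _ => ?_
    split_ifs with h
    · refine ih _ (D.pre_step x hx j h.le) ?_
      rw [act_s, h]
      simp only [map_sub, one_smul, hφ] at *
      push_cast at hn
      linarith
    · simp

theorem phi_pos (φ : D.V →ₗ[ℚ] ℚ) (hφ : ∀ i, φ (D.simple i) = 1) (β : D.V)
    (hβ : D.IsPosRoot β) : φ β = D.ht β ∧ 0 < φ β := by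
  have h1 := D.posCoeff_spec β hβ.1 hβ.2
  have h2 : φ β = D.ht β := by
    conv_lhs => rw [h1]
    simp [ht, hφ]
  refine ⟨h2, ?_⟩
  rw [h2]
  norm_cast
  rw [Nat.pos_iff_ne_zero]
  intro h0
  apply D.root_ne_zero β hβ.1
  rw [ht, Finset.sum_eq_zero_iff] at h0
  rw [h1]
  exact Finset.sum_eq_zero fun i hi => by rw [h0 i hi]; simp

theorem refRoot_pos (l : List D.I) (w : D.W) (hl : D.IsReduced l w) (j : Fin l.length) :
    D.IsPosRoot (D.refRoot l j) := by
  refine D.red_prefix_pos l w hl (l.take j) (l.get j) (l.drop (j + 1)) ?_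
  simp

theorem final (hpi : D.IsDominant pi)
    (v w : D.W) (hv : D.IsMinuscule pi v) (hw : D.IsMinuscule pi w)
    (hvr : D.IsMinRep (D.stab pi) v) (hwr : D.IsMinRep (D.stab pi) w)
    (l : List D.I) (hl : D.IsReduced l w)
    (Fv : Finset (Fin l.length)) (hfil : D.IsHeapFilter l Fv)
    (hsub : D.wordProd (D.subwordF l Fv) = v) (hcard : Fv.card = D.length v) :
    (D.RedCard (w * v⁻¹) : ℚ) =
      (D.length w - D.length v).factorial *
        ∑ A : Finset (Fin l.length),
          if D.InExcited l Fv A then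
            (∏ j ∈ Aᶜ, (D.ht (D.refRoot l j) : ℚ))⁻¹ else 0 := by
  obtain ⟨φ, hφ⟩ := D.exists_ht
  have hM := D.red_MinW pi hpi w hw hwr l hl
  set lv := D.subwordF l Fv with hlv
  have hlvlen : lv.length = D.length v := by rw [hlv, subwordF_length, hcard]
  have hlvred : D.IsReduced lv v := ⟨hsub, hlvlen⟩
  have hMv := D.red_MinW pi hpi v hv hvr lv hlvred
  have hG : D.Good pi l (D.act v pi) Fv := by
    have := D.good_subword pi l Fv hMv
    rwa [← hlv, hsub] at this
  have hle : D.length v ≤ D.length w := by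
    rw [← hcard, ← hl.2]
    simpa using Finset.card_le_univ Fv
  have hpos := fun j => D.phi_pos φ hφ _ (D.refRoot_pos l w hl j)
  have hPpos : 0 < ∏ j, φ (D.refRoot l j) := Finset.prod_pos fun j _ => (hpos j).2
  have hsum : (∑ A : Finset (Fin l.length), if D.InExcited l Fv A then
      (∏ j ∈ Aᶜ, (D.ht (D.refRoot l j) : ℚ))⁻¹ else 0) * ∏ j, φ (D.refRoot l j) =
      D.X pi φ l (D.act v pi) := by
    unfold X
    rw [Finset.sum_mul]
    refine Finset.sum_congr rfl fun A _ => ?_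
    have := D.excited_iff pi hpi l hM _ Fv hfil hG A
    by_cases h : D.Good pi l (D.act v pi) A
    · rw [if_pos h, if_pos (this.mpr h), ← Finset.prod_mul_prod_compl A]
      have e : ∏ j ∈ Aᶜ, (D.ht (D.refRoot l j) : ℚ) = ∏ j ∈ Aᶜ, φ (D.refRoot l j) :=
        Finset.prod_congr rfl fun j _ => (hpos j).1.symm
      rw [e]
      have hne : ∏ j ∈ Aᶜ, φ (D.refRoot l j) ≠ 0 :=
        (Finset.prod_pos fun j _ => (hpos j).2).ne'
      field_simp
    · rw [if_neg h, if_neg fun h' => h (this.mp h'), zero_mul]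
  have hXpos : 0 < D.X pi φ l (D.act v pi) := by
    unfold X
    refine Finset.sum_pos' (fun A _ => ?_) ⟨Fv, Finset.mem_univ _, ?_⟩
    · split_ifs
      · exact Finset.prod_nonneg fun j _ => (hpos j).2.le
      · exact le_rfl
    · rw [if_pos hG]; exact Finset.prod_pos fun j _ => (hpos j).2
  set n := D.length w - D.length v with hn
  have hphi : φ (D.act v pi - D.act (D.wordProd l) pi) = n := by
    have h1 := D.MinW_ht φ hφ pi l hM
    have h2 := D.MinW_ht φ hφ pi lv hMv
    rw [hsub, hlvlen] at h2
    rw [hl.2] at h1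
    rw [hn, Nat.cast_sub hle, ← h1, ← h2]
    simp only [map_sub]; ring
  have hc := D.count pi hpi φ hφ l hM n (D.act v pi) (D.good_pre pi hpi l _ Fv hG) hphi
  have hmem : ∀ m, m ∈ D.S (D.act (D.wordProd l) pi) n (D.act v pi) ↔ m.length = n ∧
      D.wordProd m.reverse = w * v⁻¹ := by
    intro m
    have h0 := D.mem_S pi (D.act (D.wordProd l) pi) n lv m hMv
    rw [hsub] at h0
    rw [h0]
    refine and_congr_right fun hm => ?_
    have hlen : (m.reverse ++ lv).length = D.length w := by
      rw [List.length_append, List.length_reverse, hm, hlvlen]; omega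
    constructor
    · rintro ⟨h1, h2⟩
      have h3 := D.MinW_uniq pi hpi l hM _ h2 (by
        rw [hl.2, ← hlen]; exact D.length_le _ _ rfl)
      rw [wordProd_append, hsub, hl.1] at h3
      exact eq_mul_inv_of_mul_eq h3
    · intro h
      have h1 : D.wordProd (m.reverse ++ lv) = w := by
        rw [wordProd_append, hsub, h, inv_mul_cancel_right]
      exact ⟨D.red_MinW pi hpi w hw hwr _ ⟨h1, hlen⟩, by rw [h1, hl.1]⟩
  have hlenq : D.length (w * v⁻¹) = n := by
    have hne : (D.S (D.act (D.wordProd l) pi) n (D.act v pi)).Nonempty := by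
      rw [Finset.nonempty_iff_ne_empty]
      intro h
      rw [h] at hc
      have : 0 < (n.factorial : ℚ) * D.X pi φ l (D.act v pi) :=
        mul_pos (by exact_mod_cast n.factorial_pos) hXpos
      rw [← hc] at this
      simp at this
    obtain ⟨m, hm⟩ := hne
    rw [hmem] at hm
    have h1 := D.length_le _ _ hm.2
    rw [List.length_reverse, hm.1] at h1
    have h2 := D.length_mul_le (w * v⁻¹) v
    rw [inv_mul_cancel_right] at h2
    omega
  have hred : D.RedCard (w * v⁻¹) = (D.S (D.act (D.wordProd l) pi) n (D.act v pi)).card := by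
    rw [RedCard, ← Fintype.card_coe, ← Nat.card_eq_fintype_card]
    refine Nat.card_congr ⟨fun m => ⟨m.1.reverse, ?_⟩, fun m => ⟨m.1.reverse, ?_⟩, ?_, ?_⟩
    · rw [hmem, List.length_reverse, List.reverse_reverse]
      exact ⟨m.2.2.trans hlenq, m.2.1⟩
    · have h := (hmem _).mp m.2
      exact ⟨h.2, by rw [List.length_reverse, h.1, hlenq]⟩
    · intro m; simp
    · intro m; simp
  rw [hred]
  have h3 := hPpos.ne'
  rw [← hsum, ← mul_assoc] at hc
  exact mul_right_cancel₀ h3 hc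

end Final
end WeylSetting
/-- For `π`-minuscule `v ≤ w` in `W^P` with a reduced word `l` of `w` and
`H(v)` realized as an order filter `Fv` of the heap `H(w)`:
`#Red(w v⁻¹) = (ℓ(w)-ℓ(v))! ⋅ Σ_{A ∈ E_{H(w)}(H(v))} 1/∏_{p ∈ H(w)∖A} ht(β_w(p))`. -/
theorem skew_red_count_excited
    (D : WeylSetting) (pi : D.V) (hpi : D.IsDominant pi)
    (v w : D.W) (hv : D.IsMinuscule pi v) (hw : D.IsMinuscule pi w)
    (hvr : D.IsMinRep (D.stab pi) v) (hwr : D.IsMinRep (D.stab pi) w)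
    (hvw : D.bruhatLE v w)
    (l : List D.I) (hl : D.IsReduced l w)
    (Fv : Finset (Fin l.length)) (hfil : D.IsHeapFilter l Fv)
    (hsub : D.wordProd (D.subwordF l Fv) = v) (hcard : Fv.card = D.length v) :
    (D.RedCard (w * v⁻¹) : ℚ) =
      (D.length w - D.length v).factorial *
        ∑ A : Finset (Fin l.length),
          if D.InExcited l Fv A then
            (∏ j ∈ Aᶜ, (D.ht (D.refRoot l j) : ℚ))⁻¹ else 0 := by
  exact D.final pi hpi v w hv hw hvr hwr l hl Fv hfil hsub hcard
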